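/- arXiv:0801.0394 — 2 statements merged into one kernel-verified Lean document; each statement's English description precedes it below -/
import Mathlib

section
/- Suppose 1/n ≪ ε₀ ≪ 1/k ≪ ε ≪ d ≪ c ≪ 1 (each constant is sufficiently small as a function of the constants to its right). Let R be an oriented graph on vertex set [k] such that: δ⁰(R) ≥ 2ck; |N⁺_R(S)| ≥ |S| + ck for every S ⊆ [k] with |S| ≤ (1−c)k; and 𝒞 is a 1-factor of R. Suppose R* is an oriented graph obtained from R by adding a set U₀ of at most ε₀n new vertices and some edges so that every x ∈ U₀ has both an inneighbour and an outneighbour in [k]. Suppose G* is an oriented graph on n vertices with vertex partition U₀, U₁, …, U_k such that: (i) each U_i is independent; (ii) if ij is an edge on some cycle of 𝒞 then the bipartite graph (U_i,U_j) of all U_i–U_j edges of G* is (ε,d)-super-regular, if ij ∈ E(R) then (U_i,U_j) is ε-regular of density d, and (U_i,U_j) is empty whenever ij ∉ E(R); (iii) for all x ∈ U₀ and i ∈ [k], |N⁺_{G*}(x) ∩ U_i| > c|U_i| whenever xi ∈ E(R*) and |N⁻_{G*}(x) ∩ U_i| > c|U_i| whenever ix ∈ E(R*); (iv) |U₁| =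 … = |U_k|. Then G* has a Hamilton cycle. -/
open Set

namespace ArxivOG

variable {V : Type*}

/-- An oriented graph: at most one directed edge between any two vertices (and no loops). -/
def IsOriented (G : V → V → Prop) : Prop := ∀ x y : V, G x y → ¬ G y x

/-- Out-neighbourhood of a vertex. -/
def outN (G : V → V → Prop) (x : V) : Set V := {y | G x y}

/-- In-neighbourhood of a vertex. -/
def inN (G : V → V → Prop) (x : V) : Set V := {y | G y x}

/-- Outdegree of a vertex. -/
noncomputable def outDeg (G : V → V → Prop) (x : V) : ℕ := (outN G x).ncard

/-- Indegree of a vertex. -/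
noncomputable def inDeg (G : V → V → Prop) (x : V) : ℕ := (inN G x).ncard

/-- The set of all outneighbours of vertices in `S`. -/
def outNSet (G : V → V → Prop) (S : Set V) : Set V := {y | ∃ x ∈ S, G x y}

/-- Minimum outdegree `δ⁺`. -/
noncomputable def minOutDeg (G : V → V → Prop) : ℕ := sInf (Set.range (outDeg G))

/-- Minimum indegree `δ⁻`. -/
noncomputable def minInDeg (G : V → V → Prop) : ℕ := sInf (Set.range (inDeg G))

/-- Minimum semi-degree `δ⁰ = min (δ⁺, δ⁻)`. -/
noncomputable def minSemiDeg (G : V → V → Prop) : ℕ := min (minOutDeg G) (minInDeg G)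

/-- A Hamilton cycle of a digraph, encoded as a permutation `σ` of the vertex set all of whose
vertices lie on a single cycle and such that every vertex sends an edge to its successor. -/
def IsHamCycle (G : V → V → Prop) (σ : Equiv.Perm V) : Prop :=
  (∀ v, G v (σ v)) ∧ ∀ v w : V, σ.SameCycle v w

/-- The number of edges directed from `A` to `B`. -/
noncomputable def eCnt (G : V → V → Prop) (A B : Set V) : ℕ :=
  {p : V × V | p.1 ∈ A ∧ p.2 ∈ B ∧ G p.1 p.2}.ncard

/-- The density of the bipartite graph of all `A`–`B` edges. -/
noncomputable def dens (G : V → V → Prop) (A B : Set V) : ℝ :=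
  (eCnt G A B : ℝ) / ((A.ncard : ℝ) * (B.ncard : ℝ))

/-- The pair `(A,B)` is `ε`-regular. -/
def EpsRegular (ε : ℝ) (G : V → V → Prop) (A B : Set V) : Prop :=
  ∀ X ⊆ A, ∀ Y ⊆ B, ε * A.ncard < (X.ncard : ℝ) → ε * B.ncard < (Y.ncard : ℝ) →
    |dens G X Y - dens G A B| < ε

/-- The pair `(A,B)` is `(ε,d)`-super-regular. -/
def SuperRegular (ε d : ℝ) (G : V → V → Prop) (A B : Set V) : Prop :=
  EpsRegular ε G A B ∧
  (∀ a ∈ A, (d - ε) * B.ncard ≤ ((outN G a ∩ B).ncard : ℝ)) ∧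
  (∀ b ∈ B, (d - ε) * A.ncard ≤ ((inN G b ∩ A).ncard : ℝ))

/-- The cluster `V_i` of a partition encoded by `P : V → Option (Fin k)`. -/
def cluster {k : ℕ} (P : V → Option (Fin k)) (i : Fin k) : Set V := {x | P x = some i}

/-- The exceptional set `V₀` of a partition encoded by `P : V → Option (Fin k)`. -/
def cluster0 {k : ℕ} (P : V → Option (Fin k)) : Set V := {x | P x = none}

/-- A permutation which joins every `x` to `σ x` has coarser cycles than `σ`. -/
lemma sameCycle_of_forall_step {α : Type*} {σ τ : Equiv.Perm α}
    (h : ∀ x, τ.SameCycle x (σ x)) {x y : α} (hxy : σ.SameCycle x y) : τ.SameCycle x y := by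
  have hnat : ∀ (m : ℕ) (z : α), τ.SameCycle z ((σ ^ m) z) := by
    intro m
    induction m with
    | zero => intro z; simp [Equiv.Perm.SameCycle.refl]
    | succ m ih =>
      intro z
      rw [pow_succ', Equiv.Perm.mul_apply]
      exact (ih z).trans (h _)
  obtain ⟨i, rfl⟩ := hxy
  cases i with
  | ofNat m => simpa using hnat m x
  | negSucc m =>
    have := hnat (m + 1) ((σ ^ (Int.negSucc m)) x)
    rw [← Equiv.Perm.mul_apply, zpow_negSucc, mul_inv_cancel, Equiv.Perm.one_apply] at this
    rw [zpow_negSucc]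
    exact this.symm

/-- The vertices of the cycle of `a` can be numbered along the cycle, starting after `a`. -/
lemma exists_cycle_position {α : Type*} [Finite α] (σ : Equiv.Perm α) (a : α) :
    ∃ pos : α → ℕ, (∀ x y, σ.SameCycle a x → σ.SameCycle a y → pos x = pos y → x = y) ∧
      pos (σ a) = 0 ∧ (∀ x, σ.SameCycle a x → x ≠ a → pos (σ x) = pos x + 1) ∧
      ∀ x, σ.SameCycle a x → x ≠ a → pos x < pos a := by
  classical
  have hex : ∀ x, σ.SameCycle a x → ∃ m : ℕ, (σ ^ m) (σ a) = x := by
    intro x hx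
    have : σ.SameCycle (σ a) x := by simpa using hx
    obtain ⟨i, _, hi⟩ := this.exists_pow_eq'
    exact ⟨i, hi⟩
  let pos : α → ℕ := fun x => if h : ∃ m : ℕ, (σ ^ m) (σ a) = x then Nat.find h else 0
  have hspec : ∀ x, σ.SameCycle a x → (σ ^ pos x) (σ a) = x := by
    intro x hx
    simp only [pos, dif_pos (hex x hx)]
    exact Nat.find_spec (hex x hx)
  have hle : ∀ x m, (σ ^ m) (σ a) = x → pos x ≤ m := by
    intro x m hm
    have h : ∃ m : ℕ, (σ ^ m) (σ a) = x := ⟨m, hm⟩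
    simp only [pos, dif_pos h]
    exact Nat.find_min' h hm
  have hinj : ∀ x y, σ.SameCycle a x → σ.SameCycle a y → pos x = pos y → x = y := by
    intro x y hx hy h
    rw [← hspec x hx, ← hspec y hy, h]
  refine ⟨pos, hinj, Nat.le_zero.1 (hle _ 0 (by simp)), ?_, ?_⟩
  · intro x hx hxa
    have h1 : pos (σ x) ≤ pos x + 1 := by
      apply hle
      rw [pow_succ', Equiv.Perm.mul_apply, hspec x hx]
    have h2 : (σ ^ pos (σ x)) (σ a) = σ x := hspec _ (by simpa using hx)
    rcases hq : pos (σ x) with _ | q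
    · rw [hq] at h2
      exact absurd (σ.injective (by simpa using h2)).symm hxa
    · rw [hq, pow_succ', Equiv.Perm.mul_apply] at h2
      have := hle x q (σ.injective h2)
      omega
  · intro x hx hxa
    have hper : (σ ^ (pos a + 1)) (σ a) = σ a := by
      rw [pow_succ', Equiv.Perm.mul_apply, hspec a (Equiv.Perm.SameCycle.refl _ _)]
    have hne : pos x ≠ pos a := fun h => hxa (hinj x a hx (Equiv.Perm.SameCycle.refl _ _) h)
    by_contra hlt
    obtain ⟨r, hr⟩ : ∃ r, pos x = r + (pos a + 1) := ⟨pos x - (pos a + 1), by omega⟩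
    have h1 := hspec x hx
    rw [hr, pow_add, Equiv.Perm.mul_apply, hper] at h1
    have := hle x r h1
    omega

/-- If `τ` agrees with `σ` along a segment of a cycle of `σ`, then the ends of the segment lie on
the same cycle of `τ`. -/
lemma sameCycle_of_segment {α : Type*} {σ τ : Equiv.Perm α} {a : α} {pos : α → ℕ}
    (hinj : ∀ x y, σ.SameCycle a x → σ.SameCycle a y → pos x = pos y → x = y)
    (hstep : ∀ x, σ.SameCycle a x → x ≠ a → pos (σ x) = pos x + 1)
    (hmax : ∀ x, σ.SameCycle a x → x ≠ a → pos x < pos a)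
    {x v : α} (hx : σ.SameCycle a x) (hv : σ.SameCycle a v) (hxv : pos x ≤ pos v)
    (hM : ∀ w, σ.SameCycle a w → pos x ≤ pos w → pos w < pos v → τ w = σ w) :
    τ.SameCycle x v := by
  obtain ⟨m, hm⟩ : ∃ m, pos v = pos x + m := ⟨pos v - pos x, by omega⟩
  induction m generalizing x with
  | zero => rw [hinj x v hx hv (by omega)]
  | succ m ih =>
    have hxa : x ≠ a := by
      rintro rfl
      by_cases hva : v = x
      · subst hva; omega
      · have := hmax v hv hva; omega
    have h1 := hstep x hx hxa
    have h2 : τ x = σ x := hM x hx le_rfl (by omega)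
    have h3 : τ.SameCycle (σ x) v := by
      apply ih (by simpa using hx) (by omega) _ (by omega)
      intro w hw h4 h5
      exact hM w hw (by omega) h5
    rw [← h2] at h3
    simpa using h3

/-- Exchanging the successors of two vertices on different cycles merges these cycles. -/
lemma sameCycle_mul_swap {α : Type*} [Finite α] [DecidableEq α] {σ : Equiv.Perm α} {a b : α}
    (hab : ¬ σ.SameCycle a b) :
    (σ * Equiv.swap a b).SameCycle a b ∧
      ∀ x y, σ.SameCycle x y → (σ * Equiv.swap a b).SameCycle x y := by
  set τ := σ * Equiv.swap a b with hτ
  have hτa : τ a = σ b := by simp [hτ]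
  have hτb : τ b = σ a := by simp [hτ]
  have hτo : ∀ x, x ≠ a → x ≠ b → τ x = σ x := by
    intro x h1 h2
    simp [hτ, Equiv.swap_apply_of_ne_of_ne h1 h2]
  have key : ∀ u v, ¬ σ.SameCycle u v → (∀ x, x ≠ u → x ≠ v → τ x = σ x) →
      τ.SameCycle (σ u) u := by
    intro u v huv ho
    obtain ⟨pos, hinj, h0, hstep, hmax⟩ := exists_cycle_position σ u
    refine sameCycle_of_segment hinj hstep hmax (by simp [Equiv.Perm.SameCycle.refl])
      (.refl _ _) (by omega) ?_
    intro w hw _ hlt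
    refine ho w ?_ ?_
    · rintro rfl; omega
    · rintro rfl; exact huv hw
  have ha := key a b hab hτo
  have hb := key b a (fun h => hab h.symm) (fun x h1 h2 => hτo x h2 h1)
  have h1 : τ.SameCycle a (σ b) := by rw [← hτa]; simp [Equiv.Perm.SameCycle.refl]
  have h2 : τ.SameCycle b (σ a) := by rw [← hτb]; simp [Equiv.Perm.SameCycle.refl]
  refine ⟨h1.trans hb, fun x y => sameCycle_of_forall_step ?_⟩
  intro x
  by_cases hxa : x = a
  · subst hxa; exact ha.symm
  by_cases hxb : x = b
  · subst hxb; exact hb.symm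
  rw [← hτo x hxa hxb]
  simp [Equiv.Perm.SameCycle.refl]

/-- Rerouting three vertices of a cycle without breaking it up. -/
lemma exists_perm_reroute_three {α : Type*} [DecidableEq α] {σ : Equiv.Perm α} {a : α}
    {pos : α → ℕ}
    (hinj : ∀ x y, σ.SameCycle a x → σ.SameCycle a y → pos x = pos y → x = y)
    (h0 : pos (σ a) = 0)
    (hstep : ∀ x, σ.SameCycle a x → x ≠ a → pos (σ x) = pos x + 1)
    (hmax : ∀ x, σ.SameCycle a x → x ≠ a → pos x < pos a)
    {b s : α} (hb : σ.SameCycle a b) (hs : σ.SameCycle a s)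
    (hbs : pos b < pos s) (hsa : pos s < pos a) :
    ∃ τ : Equiv.Perm α, τ a = σ b ∧ τ b = σ s ∧ τ s = σ a ∧
      (∀ x, x ≠ a → x ≠ b → x ≠ s → τ x = σ x) ∧
      ∀ x y, σ.SameCycle x y → τ.SameCycle x y := by
  have n1 : b ≠ s := by rintro rfl; omega
  have n2 : s ≠ a := by rintro rfl; omega
  have n3 : b ≠ a := by rintro rfl; omega
  set τ := σ * (Equiv.swap a b * Equiv.swap b s) with hτ
  have e1 : τ a = σ b := by
    simp [hτ, Equiv.swap_apply_of_ne_of_ne n3.symm n2.symm]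
  have e2 : τ b = σ s := by
    simp [hτ, Equiv.swap_apply_of_ne_of_ne n2 n1.symm]
  have e3 : τ s = σ a := by simp [hτ]
  have eo : ∀ x, x ≠ a → x ≠ b → x ≠ s → τ x = σ x := by
    intro x h1 h2 h3
    simp [hτ, Equiv.swap_apply_of_ne_of_ne h2 h3, Equiv.swap_apply_of_ne_of_ne h1 h2]
  refine ⟨τ, e1, e2, e3, eo, fun x y => sameCycle_of_forall_step ?_⟩
  have seg : ∀ x v, σ.SameCycle a x → σ.SameCycle a v → pos x ≤ pos v →
      ¬ (pos x ≤ pos a ∧ pos a < pos v) → ¬ (pos x ≤ pos b ∧ pos b < pos v) →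
      ¬ (pos x ≤ pos s ∧ pos s < pos v) → τ.SameCycle x v := by
    intro x v hx hv hxv ka kb ks
    refine sameCycle_of_segment hinj hstep hmax hx hv hxv ?_
    intro w _ h1 h2
    refine eo w ?_ ?_ ?_ <;> rintro rfl <;> tauto
  have pb := hstep b hb n3
  have ps := hstep s hs n2
  have s1 : τ.SameCycle (σ a) b := by
    apply seg <;> first | omega | simpa | simp [Equiv.Perm.SameCycle.refl]
  have s2 : τ.SameCycle (σ b) s := by
    apply seg <;> first | omega | simpa
  have s3 : τ.SameCycle (σ s) a := by
    apply seg <;> first | omega | simpa | exact .refl _ _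
  have t1 : τ.SameCycle a (σ b) := by rw [← e1]; simp [Equiv.Perm.SameCycle.refl]
  have t2 : τ.SameCycle b (σ s) := by rw [← e2]; simp [Equiv.Perm.SameCycle.refl]
  have t3 : τ.SameCycle s (σ a) := by rw [← e3]; simp [Equiv.Perm.SameCycle.refl]
  intro x
  by_cases hxa : x = a
  · subst hxa; exact t1.trans (s2.trans t3)
  by_cases hxb : x = b
  · subst hxb; exact t2.trans (s3.trans t1)
  by_cases hxs : x = s
  · subst hxs; exact t3.trans (s1.trans t2)
  rw [← eo x hxa hxb hxs]
  simp [Equiv.Perm.SameCycle.refl]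

/-- Rerouting five vertices of a cycle without breaking it up. -/
lemma exists_perm_reroute_five {α : Type*} [DecidableEq α] {σ : Equiv.Perm α} {a : α}
    {pos : α → ℕ}
    (hinj : ∀ x y, σ.SameCycle a x → σ.SameCycle a y → pos x = pos y → x = y)
    (h0 : pos (σ a) = 0)
    (hstep : ∀ x, σ.SameCycle a x → x ≠ a → pos (σ x) = pos x + 1)
    (hmax : ∀ x, σ.SameCycle a x → x ≠ a → pos x < pos a)
    {t j b s : α} (ht : σ.SameCycle a t) (hj : σ.SameCycle a j)
    (hb : σ.SameCycle a b) (hs : σ.SameCycle a s)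
    (htj : pos t < pos j) (hjb : pos j < pos b) (hbs : pos b < pos s) (hsa : pos s < pos a) :
    ∃ τ : Equiv.Perm α, τ a = σ b ∧ τ b = σ s ∧ τ s = σ t ∧ τ t = σ j ∧ τ j = σ a ∧
      (∀ x, x ≠ a → x ≠ b → x ≠ s → x ≠ t → x ≠ j → τ x = σ x) ∧
      ∀ x y, σ.SameCycle x y → τ.SameCycle x y := by
  have ntj : t ≠ j := by rintro rfl; omega
  have ntb : t ≠ b := by rintro rfl; omega
  have nts : t ≠ s := by rintro rfl; omega
  have nta : t ≠ a := by rintro rfl; omega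
  have njb : j ≠ b := by rintro rfl; omega
  have njs : j ≠ s := by rintro rfl; omega
  have nja : j ≠ a := by rintro rfl; omega
  have nbs : b ≠ s := by rintro rfl; omega
  have nba : b ≠ a := by rintro rfl; omega
  have nsa : s ≠ a := by rintro rfl; omega
  set τ := σ * (Equiv.swap a b * Equiv.swap b s * Equiv.swap s t * Equiv.swap t j) with hτ
  have e1 : τ a = σ b := by
    simp [τ, Equiv.swap_apply_def, *, nta.symm, nja.symm, nba.symm, nsa.symm]
  have e2 : τ b = σ s := by
    simp [τ, Equiv.swap_apply_def, *, ntb.symm, njb.symm, nbs.symm]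
  have e3 : τ s = σ t := by
    simp [τ, Equiv.swap_apply_def, *, nts.symm, njs.symm]
  have e4 : τ t = σ j := by
    simp [τ, Equiv.swap_apply_def, *, ntj.symm]
  have e5 : τ j = σ a := by
    simp [hτ]
  have eo : ∀ x, x ≠ a → x ≠ b → x ≠ s → x ≠ t → x ≠ j → τ x = σ x := by
    intro x h1 h2 h3 h4 h5
    simp [hτ, Equiv.swap_apply_of_ne_of_ne, h1, h2, h3, h4, h5]
  refine ⟨τ, e1, e2, e3, e4, e5, eo, fun x y => sameCycle_of_forall_step ?_⟩
  have seg : ∀ x v, σ.SameCycle a x → σ.SameCycle a v → pos x ≤ pos v →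
      ¬ (pos x ≤ pos a ∧ pos a < pos v) → ¬ (pos x ≤ pos b ∧ pos b < pos v) →
      ¬ (pos x ≤ pos s ∧ pos s < pos v) → ¬ (pos x ≤ pos t ∧ pos t < pos v) →
      ¬ (pos x ≤ pos j ∧ pos j < pos v) → τ.SameCycle x v := by
    intro x v hx hv hxv ka kb ks kt kj
    refine sameCycle_of_segment hinj hstep hmax hx hv hxv ?_
    intro w _ h1 h2
    refine eo w ?_ ?_ ?_ ?_ ?_ <;> rintro rfl <;> tauto
  have pt := hstep t ht nta
  have pj := hstep j hj nja
  have pb := hstep b hb nba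
  have ps := hstep s hs nsa
  have s1 : τ.SameCycle (σ a) t := by
    apply seg <;> first | omega | simpa | simp [Equiv.Perm.SameCycle.refl]
  have s2 : τ.SameCycle (σ t) j := by
    apply seg <;> first | omega | simpa
  have s3 : τ.SameCycle (σ j) b := by
    apply seg <;> first | omega | simpa
  have s4 : τ.SameCycle (σ b) s := by
    apply seg <;> first | omega | simpa
  have s5 : τ.SameCycle (σ s) a := by
    apply seg <;> first | omega | simpa | exact .refl _ _
  have t1 : τ.SameCycle a (σ b) := by rw [← e1]; simp [Equiv.Perm.SameCycle.refl]
  have t2 : τ.SameCycle b (σ s) := by rw [← e2]; simp [Equiv.Perm.SameCycle.refl]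
  have t3 : τ.SameCycle s (σ t) := by rw [← e3]; simp [Equiv.Perm.SameCycle.refl]
  have t4 : τ.SameCycle t (σ j) := by rw [← e4]; simp [Equiv.Perm.SameCycle.refl]
  have t5 : τ.SameCycle j (σ a) := by rw [← e5]; simp [Equiv.Perm.SameCycle.refl]
  have at_ : τ.SameCycle a s := t1.trans s4
  have aj : τ.SameCycle a j := at_.trans (t3.trans s2)
  have ha : τ.SameCycle a t := aj.trans (t5.trans s1)
  have ab : τ.SameCycle a b := ha.trans (t4.trans s3)
  intro x
  by_cases hxa : x = a
  · subst hxa; exact aj.trans t5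
  by_cases hxb : x = b
  · subst hxb; exact ab.symm.trans t1
  by_cases hxs : x = s
  · subst hxs; exact at_.symm.trans s5.symm
  by_cases hxt : x = t
  · subst hxt; exact ha.symm.trans (aj.trans s2.symm)
  by_cases hxj : x = j
  · subst hxj; exact aj.symm.trans (ha.trans t4)
  rw [← eo x hxa hxb hxs hxt hxj]
  simp [Equiv.Perm.SameCycle.refl]

lemma exists_card_filter_lt_eq {α : Type*} (X : Finset α) (pos : α → ℕ)
    (hinj : ∀ x ∈ X, ∀ y ∈ X, pos x = pos y → x = y) (h : ℕ) (hX : h ≤ X.card) :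
    ∃ θ, (X.filter (fun x => pos x < θ)).card = h := by
  classical
  have hex : ∃ θ, h ≤ (X.filter (fun x => pos x < θ)).card := by
    refine ⟨X.sup pos + 1, ?_⟩
    rwa [Finset.filter_true_of_mem]
    intro x hx
    exact Nat.lt_succ_of_le (Finset.le_sup hx)
  refine ⟨Nat.find hex, le_antisymm ?_ (Nat.find_spec hex)⟩
  rcases hθ : Nat.find hex with _ | q
  · simp
  · have h1 : (X.filter (fun x => pos x < q)).card < h := by
      have := Nat.find_min hex (m := q) (by omega)
      omega
    have h2 : X.filter (fun x => pos x < q + 1) ⊆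
        X.filter (fun x => pos x < q) ∪ X.filter (fun x => pos x = q) := by
      intro x
      simp only [Finset.mem_filter, Finset.mem_union]
      intro hx
      rcases Nat.lt_succ_iff_lt_or_eq.1 hx.2 with h | h
      · exact Or.inl ⟨hx.1, h⟩
      · exact Or.inr ⟨hx.1, h⟩
    have h3 : (X.filter (fun x => pos x = q)).card ≤ 1 := by
      rw [Finset.card_le_one]
      intro x hx y hy
      simp only [Finset.mem_filter] at hx hy
      exact hinj x hx.1 y hy.1 (hx.2.trans hy.2.symm)
    have h4 := (Finset.card_le_card h2).trans (Finset.card_union_le _ _)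
    omega

lemma card_filter_lt_add_le {α : Type*} (X : Finset α) (pos : α → ℕ) (θ : ℕ) :
    (X.filter (fun x => pos x < θ)).card + (X.filter (fun x => θ ≤ pos x)).card = X.card := by
  have := Finset.card_filter_add_card_filter_not (s := X) (fun x => pos x < θ)
  simpa only [not_lt] using this

/-- The vertices and edges needed to close up a Hamilton path whose last vertex has out-neighbours
governed by `I` and whose first vertex has in-neighbours `K`. -/
lemma exists_closing_pattern {α : Type*} (J : α → α → Prop) (pos : α → ℕ) (I K : Finset α) (e : ℕ)
    (hI : 8 * e + 7 ≤ I.card) (hK : 8 * e + 7 ≤ K.card)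
    (hinjI : ∀ x ∈ I, ∀ y ∈ I, pos x = pos y → x = y)
    (hinjK : ∀ x ∈ K, ∀ y ∈ K, pos x = pos y → x = y)
    (hreg : ∀ X Y : Finset α, (X ⊆ I ∨ X ⊆ K) → (Y ⊆ I ∨ Y ⊆ K) → e ≤ X.card → e ≤ Y.card →
      ∃ x ∈ X, ∃ y ∈ Y, J x y) :
    (∃ b ∈ I, ∃ s ∈ K, pos b < pos s ∧ J b s) ∨
    ∃ t ∈ K, ∃ j ∈ K, ∃ b ∈ I, ∃ s ∈ I, pos t < pos j ∧ pos j < pos b ∧ pos b < pos s ∧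
      J b s ∧ J s t ∧ J t j := by
  classical
  obtain ⟨θ, hθ⟩ := exists_card_filter_lt_eq K pos hinjK (4 * e + 3) (by omega)
  have hKθ := card_filter_lt_add_le K pos θ
  have hIθ := card_filter_lt_add_le I pos θ
  set K₁ := K.filter (fun x => pos x < θ) with hK₁
  set I₂ := I.filter (fun x => θ ≤ pos x) with hI₂
  by_cases hc : e ≤ (I.filter (fun x => pos x < θ)).card
  · left
    obtain ⟨b, hb, s, hs, hbs⟩ := hreg (I.filter (fun x => pos x < θ))
      (K.filter (fun x => θ ≤ pos x)) (Or.inl (Finset.filter_subset _ _))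
      (Or.inr (Finset.filter_subset _ _)) hc (by omega)
    simp only [Finset.mem_filter] at hb hs
    exact ⟨b, hb.1, s, hs.1, by omega, hbs⟩
  right
  have hK₁K : K₁ ⊆ K := Finset.filter_subset _ _
  have hI₂I : I₂ ⊆ I := Finset.filter_subset _ _
  obtain ⟨φ, hφ⟩ := exists_card_filter_lt_eq K₁ pos
    (fun x hx y hy => hinjK x (hK₁K hx) y (hK₁K hy)) (2 * e) (by omega)
  obtain ⟨ψ, hψ⟩ := exists_card_filter_lt_eq I₂ pos
    (fun x hx y hy => hinjI x (hI₂I hx) y (hI₂I hy)) (2 * e) (by omega)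
  have hφ' := card_filter_lt_add_le K₁ pos φ
  have hψ' := card_filter_lt_add_le I₂ pos ψ
  set T₀ := K₁.filter (fun x => pos x < φ) with hT₀
  set T₁ := K₁.filter (fun x => φ ≤ pos x) with hT₁
  set S₀ := I₂.filter (fun x => pos x < ψ) with hS₀
  set S₁ := I₂.filter (fun x => ψ ≤ pos x) with hS₁
  have hT₀K : T₀ ⊆ K := (Finset.filter_subset _ _).trans hK₁K
  have hT₁K : T₁ ⊆ K := (Finset.filter_subset _ _).trans hK₁K
  have hS₀I : S₀ ⊆ I := (Finset.filter_subset _ _).trans hI₂I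
  have hS₁I : S₁ ⊆ I := (Finset.filter_subset _ _).trans hI₂I
  have hT : e ≤ (T₀.filter (fun t => ∃ j ∈ T₁, J t j)).card := by
    have h1 := Finset.card_filter_add_card_filter_not (s := T₀) (fun t => ∃ j ∈ T₁, J t j)
    by_contra hlt
    obtain ⟨x, hx, y, hy, hxy⟩ := hreg (T₀.filter (fun t => ¬ ∃ j ∈ T₁, J t j)) T₁
      (Or.inr ((Finset.filter_subset _ _).trans hT₀K)) (Or.inr hT₁K) (by omega) (by omega)
    exact (Finset.mem_filter.1 hx).2 ⟨y, hy, hxy⟩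
  have hS : e ≤ (S₁.filter (fun s => ∃ b ∈ S₀, J b s)).card := by
    have h1 := Finset.card_filter_add_card_filter_not (s := S₁) (fun s => ∃ b ∈ S₀, J b s)
    by_contra hlt
    obtain ⟨x, hx, y, hy, hxy⟩ := hreg S₀ (S₁.filter (fun s => ¬ ∃ b ∈ S₀, J b s))
      (Or.inl hS₀I) (Or.inl ((Finset.filter_subset _ _).trans hS₁I)) (by omega) (by omega)
    exact (Finset.mem_filter.1 hy).2 ⟨x, hx, hxy⟩
  obtain ⟨s, hs, t, ht, hst⟩ := hreg _ _ (Or.inl ((Finset.filter_subset _ _).trans hS₁I))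
    (Or.inr ((Finset.filter_subset _ _).trans hT₀K)) hS hT
  obtain ⟨hs, b, hb, hbs⟩ := Finset.mem_filter.1 hs
  obtain ⟨ht, j, hj, htj⟩ := Finset.mem_filter.1 ht
  refine ⟨t, hT₀K ht, j, hT₁K hj, b, hS₀I hb, s, hS₁I hs, ?_, ?_, ?_, hbs, hst, htj⟩
  · have h1 := (Finset.mem_filter.1 ht).2
    have h2 := (Finset.mem_filter.1 hj).2
    omega
  · have h1 := (Finset.mem_filter.1 (Finset.mem_filter.1 hj).1).2
    have h2 := (Finset.mem_filter.1 (Finset.mem_filter.1 hb).1).2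
    omega
  · have h1 := (Finset.mem_filter.1 hb).2
    have h2 := (Finset.mem_filter.1 hs).2
    omega

lemma ncard_sameCycle_lt {α : Type*} [Finite α] {σ τ : Equiv.Perm α}
    (h : ∀ x y, σ.SameCycle x y → τ.SameCycle x y) {a b : α} (hσ : ¬ σ.SameCycle a b)
    (hτ : τ.SameCycle a b) :
    {p : α × α | σ.SameCycle p.1 p.2}.ncard < {p : α × α | τ.SameCycle p.1 p.2}.ncard := by
  refine Set.ncard_lt_ncard ⟨fun p hp => h _ _ hp, fun hsub => hσ ?_⟩ (Set.toFinite _)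
  exact hsub (a := (a, b)) hτ

/-- The permutations agreeing with `σ` outside `A`, coarser than `σ`, mapping `A` onto `B` and
following edges of `G` on `A`, with the possible exception of the vertex `a`. -/
structure IsAlmostFactor {α : Type*} (G : α → α → Prop) (A B : Finset α) (σ τ : Equiv.Perm α)
    (a : α) : Prop where
  mem : a ∈ A
  eq_off : ∀ x, x ∉ A → τ x = σ x
  edge : ∀ x ∈ A, x ≠ a → G x (τ x)
  mem_iff : ∀ x, x ∈ A ↔ τ x ∈ B
  coarser : ∀ x y, σ.SameCycle x y → τ.SameCycle x y

/-- Rerouting within `A` preserves the property of mapping exactly `A` into `B`. -/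
lemma mem_iff_mul {α : Type*} {A B : Finset α} {σ π : Equiv.Perm α}
    (h : ∀ x, x ∈ A ↔ σ x ∈ B) (hπ : ∀ x, x ∈ A ↔ π x ∈ A) (x : α) :
    x ∈ A ↔ (σ * π) x ∈ B := by
  rw [Equiv.Perm.mul_apply, ← h, ← hπ]

lemma mem_iff_swap {α : Type*} [DecidableEq α] {A : Finset α} {u v : α} (hu : u ∈ A) (hv : v ∈ A)
    (x : α) : x ∈ A ↔ Equiv.swap u v x ∈ A := by
  rcases eq_or_ne x u with rfl | h1
  · simp [hu, hv]
  rcases eq_or_ne x v with rfl | h2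
  · simp [hu, hv]
  rw [Equiv.swap_apply_of_ne_of_ne h1 h2]

/-- Two permutations agreeing outside `A` map `A` onto the same set. -/
lemma mem_iff_of_eq_off {α : Type*} {A B : Finset α} {σ τ : Equiv.Perm α}
    (h : ∀ x, x ∈ A ↔ σ x ∈ B) (ho : ∀ x ∈ A, ∃ y ∈ A, τ x = σ y) (hoff : ∀ x, x ∉ A → τ x = σ x)
    (x : α) : x ∈ A ↔ τ x ∈ B := by
  constructor
  · intro hx
    obtain ⟨y, hy, hxy⟩ := ho x hx
    rw [hxy, ← h]
    exact hy
  · intro hx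
    by_contra hxA
    rw [hoff x hxA, ← h] at hx
    exact hxA hx

/-- The exceptional vertex of an almost factor can be moved so as to merge two cycles. -/
lemma IsAlmostFactor.merge {α : Type*} [Finite α] [DecidableEq α] {G : α → α → Prop}
    {A B : Finset α} {σ τ : Equiv.Perm α} {a u v : α} (h : IsAlmostFactor G A B σ τ a)
    (hu : u ∈ A) (hv : v ∈ A) (huv : ¬ τ.SameCycle u v) (hG : G u (τ v)) (hauv : a = u ∨ a = v) :
    IsAlmostFactor G A B σ (τ * Equiv.swap u v) v ∧
      {p : α × α | τ.SameCycle p.1 p.2}.ncard <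
        {p : α × α | (τ * Equiv.swap u v).SameCycle p.1 p.2}.ncard := by
  obtain ⟨h1, h2⟩ := sameCycle_mul_swap huv
  refine ⟨⟨hv, ?_, ?_, mem_iff_mul h.mem_iff (mem_iff_swap hu hv), fun x y hxy =>
    h2 _ _ (h.coarser _ _ hxy)⟩, ncard_sameCycle_lt h2 huv h1⟩
  · intro x hx
    rw [Equiv.Perm.mul_apply, Equiv.swap_apply_of_ne_of_ne, h.eq_off x hx]
    · rintro rfl; exact hx hu
    · rintro rfl; exact hx hv
  · intro x hx hxv
    rw [Equiv.Perm.mul_apply]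
    rcases eq_or_ne x u with rfl | hxu
    · simpa using hG
    rw [Equiv.swap_apply_of_ne_of_ne hxu hxv]
    refine h.edge x hx ?_
    rintro rfl
    rcases hauv with h | h <;> contradiction

open Classical in
/-- If all neighbours governing the exceptional vertex lie on its cycle, then this cycle can be
closed up. -/
lemma IsAlmostFactor.close {α : Type*} [Finite α] {G : α → α → Prop}
    {A B : Finset α} {σ τ : Equiv.Perm α} {a : α} (h : IsAlmostFactor G A B σ τ a)
    (e D : ℕ) (hD : 8 * e + 8 ≤ D)
    (hout : D ≤ (A.filter (fun v => G a (τ v))).card)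
    (hin : D ≤ (A.filter (fun u => G u (τ a))).card)
    (hreg : ∀ X ⊆ A, ∀ Y ⊆ A, e ≤ X.card → e ≤ Y.card → ∃ x ∈ X, ∃ y ∈ Y, G x (τ y))
    (hI : ∀ v ∈ A, G a (τ v) → τ.SameCycle a v) (hK : ∀ u ∈ A, G u (τ a) → τ.SameCycle a u) :
    ∃ τ' : Equiv.Perm α, IsAlmostFactor G A B σ τ' a ∧ G a (τ' a) ∧
      ∀ x y, τ.SameCycle x y → τ'.SameCycle x y := by
  obtain ⟨pos, hinj, h0, hstep, hmax⟩ := exists_cycle_position τ a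
  set I := (A.filter (fun v => G a (τ v))).erase a with hIdef
  set K := (A.filter (fun u => G u (τ a))).erase a with hKdef
  have hIm : ∀ x ∈ I, x ∈ A ∧ τ.SameCycle a x ∧ pos x < pos a ∧ G a (τ x) := by
    intro x hx
    simp only [hIdef, Finset.mem_erase, Finset.mem_filter] at hx
    have := hI x hx.2.1 hx.2.2
    exact ⟨hx.2.1, this, hmax x this hx.1, hx.2.2⟩
  have hKm : ∀ x ∈ K, x ∈ A ∧ τ.SameCycle a x ∧ pos x < pos a ∧ G x (τ a) := by
    intro x hx
    simp only [hKdef, Finset.mem_erase, Finset.mem_filter] at hx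
    have := hK x hx.2.1 hx.2.2
    exact ⟨hx.2.1, this, hmax x this hx.1, hx.2.2⟩
  have hIc : 8 * e + 7 ≤ I.card := by
    have : _ ≤ I.card := Finset.pred_card_le_card_erase
    omega
  have hKc : 8 * e + 7 ≤ K.card := by
    have : _ ≤ K.card := Finset.pred_card_le_card_erase
    omega
  have hsub : ∀ X : Finset α, X ⊆ I ∨ X ⊆ K → X ⊆ A := by
    rintro X (hX | hX) x hx
    · exact (hIm x (hX hx)).1
    · exact (hKm x (hX hx)).1
  rcases exists_closing_pattern (fun x y => G x (τ y)) pos I K e hIc hKc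
    (fun x hx y hy => hinj x y (hIm x hx).2.1 (hIm y hy).2.1)
    (fun x hx y hy => hinj x y (hKm x hx).2.1 (hKm y hy).2.1)
    (fun X Y hX hY => hreg X (hsub X hX) Y (hsub Y hY)) with
    ⟨b, hb, s, hs, hbs, hGbs⟩ | ⟨t, ht, j, hj, b, hb, s, hs, htj, hjb, hbs, hGbs, hGst, hGtj⟩
  · obtain ⟨hbA, hbC, _, hbG⟩ := hIm b hb
    obtain ⟨hsA, hsC, hsa, hsG⟩ := hKm s hs
    obtain ⟨τ', ea, eb, es, eo, hc⟩ :=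
      exists_perm_reroute_three hinj h0 hstep hmax hbC hsC hbs hsa
    have heq : ∀ x, x ∉ A → τ' x = τ x := by
      intro x hx
      refine eo x ?_ ?_ ?_ <;> rintro rfl
      · exact hx h.mem
      · exact hx hbA
      · exact hx hsA
    refine ⟨τ', ⟨h.mem, fun x hx => (heq x hx).trans (h.eq_off x hx), ?_,
      mem_iff_of_eq_off h.mem_iff ?_ heq, fun x y hxy => hc _ _ (h.coarser _ _ hxy)⟩, ?_, hc⟩
    · intro x hx hxa
      by_cases hxb : x = b
      · rw [hxb, eb]; exact hGbs
      by_cases hxs : x = s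
      · rw [hxs, es]; exact hsG
      rw [eo x hxa hxb hxs]
      exact h.edge x hx hxa
    · intro x hx
      by_cases hxa : x = a
      · exact ⟨b, hbA, hxa ▸ ea⟩
      by_cases hxb : x = b
      · exact ⟨s, hsA, hxb ▸ eb⟩
      by_cases hxs : x = s
      · exact ⟨a, h.mem, hxs ▸ es⟩
      exact ⟨x, hx, eo x hxa hxb hxs⟩
    · rw [ea]; exact hbG
  · obtain ⟨htA, htC, _, _⟩ := hKm t ht
    obtain ⟨hjA, hjC, _, hjG⟩ := hKm j hj
    obtain ⟨hbA, hbC, _, hbG⟩ := hIm b hb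
    obtain ⟨hsA, hsC, hsa, _⟩ := hIm s hs
    obtain ⟨τ', ea, eb, es, et, ej, eo, hc⟩ :=
      exists_perm_reroute_five hinj h0 hstep hmax htC hjC hbC hsC htj hjb hbs hsa
    have heq : ∀ x, x ∉ A → τ' x = τ x := by
      intro x hx
      refine eo x ?_ ?_ ?_ ?_ ?_ <;> rintro rfl
      · exact hx h.mem
      · exact hx hbA
      · exact hx hsA
      · exact hx htA
      · exact hx hjA
    refine ⟨τ', ⟨h.mem, fun x hx => (heq x hx).trans (h.eq_off x hx), ?_,
      mem_iff_of_eq_off h.mem_iff ?_ heq, fun x y hxy => hc _ _ (h.coarser _ _ hxy)⟩, ?_, hc⟩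
    · intro x hx hxa
      by_cases hxb : x = b
      · rw [hxb, eb]; exact hGbs
      by_cases hxs : x = s
      · rw [hxs, es]; exact hGst
      by_cases hxt : x = t
      · rw [hxt, et]; exact hGtj
      by_cases hxj : x = j
      · rw [hxj, ej]; exact hjG
      rw [eo x hxa hxb hxs hxt hxj]
      exact h.edge x hx hxa
    · intro x hx
      by_cases hxa : x = a
      · exact ⟨b, hbA, hxa ▸ ea⟩
      by_cases hxb : x = b
      · exact ⟨s, hsA, hxb ▸ eb⟩
      by_cases hxs : x = s
      · exact ⟨t, htA, hxs ▸ es⟩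
      by_cases hxt : x = t
      · exact ⟨j, hjA, hxt ▸ et⟩
      by_cases hxj : x = j
      · exact ⟨a, h.mem, hxj ▸ ej⟩
      exact ⟨x, hx, eo x hxa hxb hxs hxt hxj⟩
    · rw [ea]; exact hbG

open Classical in
/-- A `1`-factor can be changed inside a pair `(A, B)` of large minimum degree without sparse
spots so that `A` ends up on a single cycle, while no cycle is broken up. -/
lemma exists_perm_merge {α : Type*} [Finite α] {G : α → α → Prop}
    {A B : Finset α} {σ : Equiv.Perm α} (e D : ℕ) (hD : 8 * e + 8 ≤ D)
    (hout : ∀ a ∈ A, D ≤ (B.filter (fun b => G a b)).card)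
    (hin : ∀ b ∈ B, D ≤ (A.filter (fun a => G a b)).card)
    (hreg : ∀ X ⊆ A, ∀ Y ⊆ B, e ≤ X.card → e ≤ Y.card → ∃ x ∈ X, ∃ y ∈ Y, G x y)
    (hσ : ∀ x, x ∈ A ↔ σ x ∈ B) (hG : ∀ x ∈ A, G x (σ x)) :
    ∃ τ : Equiv.Perm α, (∀ x, x ∉ A → τ x = σ x) ∧ (∀ x ∈ A, G x (τ x)) ∧
      (∀ x, x ∈ A ↔ τ x ∈ B) ∧ (∀ x y, σ.SameCycle x y → τ.SameCycle x y) ∧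
      ∀ x ∈ A, ∀ y ∈ A, τ.SameCycle x y := by
  rcases A.eq_empty_or_nonempty with rfl | ⟨a₀, ha₀⟩
  · exact ⟨σ, fun _ _ => rfl, hG, hσ, fun _ _ h => h, by simp⟩
  obtain ⟨⟨τ, a⟩, hτ, hmax⟩ := Set.exists_max_image
    {p : Equiv.Perm α × α | IsAlmostFactor G A B σ p.1 p.2}
    (fun p => {q : α × α | p.1.SameCycle q.1 q.2}.ncard) (Set.toFinite _)
    ⟨(σ, a₀), ha₀, fun _ _ => rfl, fun x hx _ => hG x hx, hσ, fun _ _ h => h⟩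
  have hmax' : ∀ τ' c, IsAlmostFactor G A B σ τ' c →
      ¬ {q : α × α | τ.SameCycle q.1 q.2}.ncard < {q : α × α | τ'.SameCycle q.1 q.2}.ncard :=
    fun τ' c h => not_lt.2 (hmax (τ', c) h)
  have hτ : IsAlmostFactor G A B σ τ a := hτ
  have trans_out : ∀ τ' c, IsAlmostFactor G A B σ τ' c → ∀ a ∈ A,
      D ≤ (A.filter (fun v => G a (τ' v))).card := by
    intro τ' c h a ha
    refine (hout a ha).trans ?_
    rw [← Finset.card_map τ'.toEmbedding (s := A.filter _)]
    refine Finset.card_le_card fun b hb => ?_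
    obtain ⟨hb, hab⟩ := Finset.mem_filter.1 hb
    refine Finset.mem_map.2 ⟨τ'.symm b, Finset.mem_filter.2 ⟨?_, ?_⟩, by simp⟩
    · rw [h.mem_iff]; simpa
    · simpa
  have trans_in : ∀ τ' c, IsAlmostFactor G A B σ τ' c → ∀ a ∈ A,
      D ≤ (A.filter (fun u => G u (τ' a))).card :=
    fun τ' c h a ha => hin _ ((h.mem_iff a).1 ha)
  have trans_reg : ∀ τ' c, IsAlmostFactor G A B σ τ' c →
      ∀ X ⊆ A, ∀ Y ⊆ A, e ≤ X.card → e ≤ Y.card → ∃ x ∈ X, ∃ y ∈ Y, G x (τ' y) := by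
    intro τ' c h X hX Y hY hXe hYe
    obtain ⟨x, hx, y, hy, hxy⟩ := hreg X hX (Y.map τ'.toEmbedding) (by
      intro y hy
      obtain ⟨z, hz, rfl⟩ := Finset.mem_map.1 hy
      exact (h.mem_iff z).1 (hY hz)) hXe (by simpa using hYe)
    obtain ⟨z, hz, rfl⟩ := Finset.mem_map.1 hy
    exact ⟨x, hx, z, hz, hxy⟩
  obtain ⟨τ', h', hGa, hc⟩ := hτ.close e D hD (trans_out τ a hτ a hτ.mem)
    (trans_in τ a hτ a hτ.mem) (trans_reg τ a hτ)
    (by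
      intro v hv hGv
      by_contra hn
      obtain ⟨h1, h2⟩ := hτ.merge hτ.mem hv hn hGv (Or.inl rfl)
      exact hmax' _ _ h1 h2)
    (by
      intro u hu hGu
      by_contra hn
      obtain ⟨h1, h2⟩ := hτ.merge hu hτ.mem (fun h => hn h.symm) hGu (Or.inr rfl)
      exact hmax' _ _ h1 h2)
  have hall : ∀ x ∈ A, G x (τ' x) := by
    intro x hx
    rcases eq_or_ne x a with rfl | hxa
    · exact hGa
    · exact h'.edge x hx hxa
  have hmax'' : ∀ u ∈ A, ∀ v ∈ A, G u (τ' v) → τ'.SameCycle u v := by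
    intro u hu v hv hGuv
    by_contra hn
    have h'' : IsAlmostFactor G A B σ τ' v := { h' with mem := hv, edge := fun x hx _ => hall x hx }
    obtain ⟨h1, h2⟩ := h''.merge hu hv hn hGuv (Or.inr rfl)
    refine hmax' _ _ h1 (lt_of_le_of_lt ?_ h2)
    exact Set.ncard_le_ncard (fun p hp => hc _ _ hp) (Set.toFinite _)
  refine ⟨τ', h'.eq_off, hall, h'.mem_iff, h'.coarser, fun x hx y hy => ?_⟩
  have large : ∀ x ∈ A, e ≤ (A.filter (fun v => τ'.SameCycle x v)).card := by
    intro x hx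
    have h1 := trans_out τ' a h' x hx
    have h2 : A.filter (fun v => G x (τ' v)) ⊆ A.filter (fun v => τ'.SameCycle x v) := by
      intro v hv
      obtain ⟨hv, hxv⟩ := Finset.mem_filter.1 hv
      exact Finset.mem_filter.2 ⟨hv, hmax'' x hx v hv hxv⟩
    have := Finset.card_le_card h2
    omega
  obtain ⟨u, hu, v, hv, huv⟩ := trans_reg τ' a h' _ (Finset.filter_subset _ _) _
    (Finset.filter_subset _ _) (large x hx) (large y hy)
  obtain ⟨hu, hxu⟩ := Finset.mem_filter.1 hu
  obtain ⟨hv, hyv⟩ := Finset.mem_filter.1 hv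
  exact hxu.trans ((hmax'' u hu v hv huv).trans hyv.symm)

open Classical in
/-- A balanced pair of large minimum degree without sparse spots has a perfect matching. -/
lemma exists_matching {α : Type*} {G : α → α → Prop} {A B : Finset α} (e D : ℕ) (hD : e ≤ D)
    (hcard : A.card = B.card)
    (hout : ∀ a ∈ A, D ≤ (B.filter (fun b => G a b)).card)
    (hin : ∀ b ∈ B, D ≤ (A.filter (fun a => G a b)).card)
    (hreg : ∀ X ⊆ A, ∀ Y ⊆ B, e ≤ X.card → e ≤ Y.card → ∃ x ∈ X, ∃ y ∈ Y, G x y) :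
    ∃ f : α → α, (∀ a ∈ A, f a ∈ B ∧ G a (f a)) ∧ ∀ a ∈ A, ∀ a' ∈ A, f a = f a' → a = a' := by
  have hall : ∀ S : Finset A, S.card ≤ (S.biUnion (fun a => B.filter (fun b => G a b))).card := by
    intro S
    rcases S.eq_empty_or_nonempty with rfl | ⟨a, ha⟩
    · simp
    have hsub : B.filter (fun b => G a b) ⊆ S.biUnion (fun a => B.filter (fun b => G a b)) :=
      Finset.subset_biUnion_of_mem (fun a : A => B.filter (fun b => G a b)) ha
    have h1 := Finset.card_le_card hsub
    have h2 := hout a a.2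
    by_cases hSe : S.card < e
    · omega
    have hSA : S.map (Function.Embedding.subtype _) ⊆ A := by
      intro x hx
      obtain ⟨y, _, rfl⟩ := Finset.mem_map.1 hx
      exact y.2
    have hSm : (S.map (Function.Embedding.subtype _)).card = S.card := Finset.card_map _
    have hSA' := Finset.card_le_card hSA
    set T := S.biUnion (fun a => B.filter (fun b => G a b)) with hT
    have hTB : T ⊆ B := Finset.biUnion_subset.2 fun a _ => Finset.filter_subset _ _
    have hTm : ∀ s ∈ S, ∀ b ∈ B, G s b → b ∈ T := fun s hs b hb hsb =>
      Finset.mem_biUnion.2 ⟨s, hs, Finset.mem_filter.2 ⟨hb, hsb⟩⟩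
    have hdiff : (B \ T).card = B.card - T.card := Finset.card_sdiff_of_subset hTB
    by_cases hbig : A.card < S.card + D
    · have : T = B := by
        refine Finset.Subset.antisymm hTB fun b hb => ?_
        by_contra hbT
        have h3 : Disjoint (S.map (Function.Embedding.subtype _)) (A.filter (fun a => G a b)) := by
          rw [Finset.disjoint_left]
          intro x hx hx'
          obtain ⟨y, hy, rfl⟩ := Finset.mem_map.1 hx
          exact hbT (hTm y hy b hb (Finset.mem_filter.1 hx').2)
        have h4 := Finset.card_le_card (Finset.union_subset hSA (Finset.filter_subset _ A) :
          _ ∪ A.filter (fun a => G a b) ⊆ A)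
        rw [Finset.card_union_of_disjoint h3] at h4
        have := hin b hb
        omega
      rw [this]
      omega
    · have h3 : (B \ T).card < e := by
        by_contra hge
        obtain ⟨x, hx, y, hy, hxy⟩ := hreg _ hSA (B \ T) Finset.sdiff_subset (by omega) (by omega)
        obtain ⟨z, hz, rfl⟩ := Finset.mem_map.1 hx
        obtain ⟨hy, hyT⟩ := Finset.mem_sdiff.1 hy
        exact hyT (hTm z hz y hy hxy)
      omega
  obtain ⟨f, hf, hfm⟩ := (Finset.all_card_le_biUnion_card_iff_exists_injective _).1 hall
  refine ⟨fun a => if h : a ∈ A then f ⟨a, h⟩ else a, ?_, ?_⟩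
  · intro a ha
    have := Finset.mem_filter.1 (hfm ⟨a, ha⟩)
    simpa [ha] using this
  · intro a ha a' ha' h
    simp only [ha, ha', dif_pos] at h
    exact congrArg Subtype.val (hf h)

/-- Greedy choice of disjoint pairs. -/
lemma exists_disjoint_pairs {Q α : Type*} [Fintype Q] [DecidableEq α] (L : Q → α → α → Prop)
    (h : ∀ q, ∀ F : Finset α, F.card ≤ 2 * Fintype.card Q →
      ∃ u w, u ∉ F ∧ w ∉ F ∧ u ≠ w ∧ L q u w) :
    ∃ u w : Q → α, Function.Injective u ∧ Function.Injective w ∧ (∀ q q', u q ≠ w q') ∧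
      ∀ q, L q (u q) (w q) := by
  classical
  suffices H : ∀ s : Finset Q, ∃ u w : Q → α, (∀ q ∈ s, ∀ q' ∈ s, u q = u q' → q = q') ∧
      (∀ q ∈ s, ∀ q' ∈ s, w q = w q' → q = q') ∧ (∀ q ∈ s, ∀ q' ∈ s, u q ≠ w q') ∧
      ∀ q ∈ s, L q (u q) (w q) by
    obtain ⟨u, w, h1, h2, h3, h4⟩ := H Finset.univ
    exact ⟨u, w, fun q q' => h1 q (by simp) q' (by simp), fun q q' => h2 q (by simp) q' (by simp),
      fun q q' => h3 q (by simp) q' (by simp), fun q => h4 q (by simp)⟩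
  intro s
  induction s using Finset.induction_on with
  | empty =>
    choose u w _ using fun q => h q ∅ (by simp)
    exact ⟨u, w, by simp, by simp, by simp, by simp⟩
  | insert q s hqs ih =>
    obtain ⟨u, w, h1, h2, h3, h4⟩ := ih
    obtain ⟨u₀, w₀, hu, hw, huw, hL⟩ := h q (s.image u ∪ s.image w) (by
      have a1 := Finset.card_union_le (s.image u) (s.image w)
      have a2 : (s.image u).card ≤ s.card := Finset.card_image_le
      have a3 : (s.image w).card ≤ s.card := Finset.card_image_le
      have a4 := Finset.card_le_univ s
      omega)
    simp only [Finset.mem_union, Finset.mem_image, not_or, not_exists, not_and] at hu hw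
    have hne : ∀ q' ∈ s, q' ≠ q := fun q' hq' h => hqs (h ▸ hq')
    refine ⟨Function.update u q u₀, Function.update w q w₀, ?_, ?_, ?_, ?_⟩
    · intro a ha b hb
      rcases Finset.mem_insert.1 ha with rfl | ha' <;> rcases Finset.mem_insert.1 hb with rfl | hb'
      · simp
      · simpa [hne b hb'] using fun hab => absurd hab.symm (hu.1 b hb')
      · simpa [hne a ha'] using fun hab => absurd hab (hu.1 a ha')
      · simpa [hne a ha', hne b hb'] using h1 a ha' b hb'
    · intro a ha b hb
      rcases Finset.mem_insert.1 ha with rfl | ha' <;> rcases Finset.mem_insert.1 hb with rfl | hb'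
      · simp
      · simpa [hne b hb'] using fun hab => absurd hab.symm (hw.2 b hb')
      · simpa [hne a ha'] using fun hab => absurd hab (hw.2 a ha')
      · simpa [hne a ha', hne b hb'] using h2 a ha' b hb'
    · intro a ha b hb
      rcases Finset.mem_insert.1 ha with rfl | ha' <;> rcases Finset.mem_insert.1 hb with rfl | hb'
      · simpa using huw
      · simpa [hne b hb'] using fun hab => absurd hab.symm (hu.2 b hb')
      · simpa [hne a ha'] using hw.1 a ha'
      · simpa [hne a ha', hne b hb'] using h3 a ha' b hb'
    · intro a ha
      rcases Finset.mem_insert.1 ha with rfl | ha'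
      · simpa using hL
      · simpa [hne a ha'] using h4 a ha'

/-- In a digraph all of whose vertex sets expand until they dominate everything, any two vertices
are joined by a walk of length equal to the number of vertices. -/
lemma exists_walk_of_expanding {ι : Type*} [Fintype ι] (T : ι → ι → Prop)
    (hT : ∀ S : Set ι, S.Nonempty → (∀ z, ∃ y ∈ S, T y z) ∨
      S.ncard < {z | ∃ y ∈ S, T y z}.ncard) (y z : ι) :
    ∃ v : ℕ → ι, v 0 = y ∧ v (Fintype.card ι) = z ∧
      ∀ m < Fintype.card ι, T (v m) (v (m + 1)) := by
  let S : ℕ → Set ι := fun m => {z | ∃ v : ℕ → ι, v 0 = y ∧ v m = z ∧ ∀ i < m, T (v i) (v (i + 1))}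
  have hS : ∀ m, ∀ z, z ∈ S (m + 1) ↔ ∃ x ∈ S m, T x z := by
    intro m z
    constructor
    · rintro ⟨v, h1, rfl, h3⟩
      exact ⟨v m, ⟨v, h1, rfl, fun i hi => h3 i (by omega)⟩, h3 m (by omega)⟩
    · rintro ⟨x, ⟨v, h1, rfl, h3⟩, hxz⟩
      refine ⟨fun i => if i ≤ m then v i else z, by simpa, by simp, fun i hi => ?_⟩
      rcases Nat.lt_or_ge i m with hi' | hi'
      · simpa [hi'.le, Nat.succ_le_of_lt hi'] using h3 i hi'
      · obtain rfl : i = m := by omega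
        simpa using hxz
  have hSet : ∀ m, S (m + 1) = {z | ∃ x ∈ S m, T x z} := fun m => Set.ext (hS m)
  have claim : ∀ m, S m = Set.univ ∨ m + 1 ≤ (S m).ncard := by
    intro m
    induction m with
    | zero =>
      right
      have : y ∈ S 0 := ⟨fun _ => y, rfl, rfl, by simp⟩
      exact (Set.ncard_pos (Set.toFinite _)).2 ⟨y, this⟩
    | succ m ih =>
      rcases ih with ih | ih
      · left
        rcases hT (S m) (ih ▸ ⟨y, trivial⟩) with h | h
        · exact Set.eq_univ_of_forall fun z => (hS m z).2 (h z)
        · exfalso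
          have := Set.ncard_le_ncard (Set.subset_univ {z | ∃ y ∈ S m, T y z}) (Set.toFinite _)
          rw [← ih] at this
          omega
      · rcases hT (S m) ((Set.ncard_pos (Set.toFinite _)).1 (by omega)) with h | h
        · exact Or.inl (Set.eq_univ_of_forall fun z => (hS m z).2 (h z))
        · right
          rw [hSet]
          omega
  have : S (Fintype.card ι) = Set.univ := by
    rcases claim (Fintype.card ι) with h | h
    · exact h
    · have h2 := Set.ncard_le_ncard (Set.subset_univ (S (Fintype.card ι))) (Set.toFinite _)
      rw [Set.ncard_univ, Nat.card_eq_fintype_card] at h2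
      omega
  have hz : z ∈ S (Fintype.card ι) := by rw [this]; trivial
  exact hz

open Classical in
/-- A permutation which is a `1`-factor can be changed inside several disjoint pairs
simultaneously so that each of them ends up on a single cycle. -/
lemma exists_perm_merge_family {α ι : Type*} [Finite α] [Fintype ι] {G : α → α → Prop}
    {A B : ι → Finset α} {σ : Equiv.Perm α} (e D : ℕ) (hD : 8 * e + 8 ≤ D)
    (hA : ∀ i j x, x ∈ A i → x ∈ A j → i = j) (hB : ∀ i j x, x ∈ B i → x ∈ B j → i = j)
    (hout : ∀ i, ∀ a ∈ A i, D ≤ ((B i).filter (fun b => G a b)).card)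
    (hin : ∀ i, ∀ b ∈ B i, D ≤ ((A i).filter (fun a => G a b)).card)
    (hreg : ∀ i, ∀ X ⊆ A i, ∀ Y ⊆ B i, e ≤ X.card → e ≤ Y.card → ∃ x ∈ X, ∃ y ∈ Y, G x y)
    (hσ : ∀ i x, x ∈ A i ↔ σ x ∈ B i) (hG : ∀ x, G x (σ x)) :
    ∃ τ : Equiv.Perm α, (∀ x, (∀ i, x ∉ A i) → τ x = σ x) ∧ (∀ x, G x (τ x)) ∧
      (∀ i x, x ∈ A i ↔ τ x ∈ B i) ∧ ∀ i, ∀ x ∈ A i, ∀ y ∈ A i, τ.SameCycle x y := by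
  suffices H : ∀ s : Finset ι, ∃ τ : Equiv.Perm α, (∀ x, (∀ i, x ∉ A i) → τ x = σ x) ∧
      (∀ x, G x (τ x)) ∧ (∀ i x, x ∈ A i ↔ τ x ∈ B i) ∧
      ∀ i ∈ s, ∀ x ∈ A i, ∀ y ∈ A i, τ.SameCycle x y by
    obtain ⟨τ, h1, h2, h3, h4⟩ := H Finset.univ
    exact ⟨τ, h1, h2, h3, fun i => h4 i (Finset.mem_univ i)⟩
  intro s
  induction s using Finset.induction_on with
  | empty => exact ⟨σ, fun _ _ => rfl, hG, hσ, by simp⟩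
  | insert i s _ ih =>
    obtain ⟨τ, h1, h2, h3, h4⟩ := ih
    obtain ⟨τ', k1, k2, k3, k4, k5⟩ := exists_perm_merge e D hD (hout i) (hin i) (hreg i) (h3 i)
      (fun x _ => h2 x)
    refine ⟨τ', fun x hx => (k1 x (hx i)).trans (h1 x hx), fun x => ?_, fun j x => ?_, ?_⟩
    · by_cases hx : x ∈ A i
      · exact k2 x hx
      · rw [k1 x hx]; exact h2 x
    · by_cases hx : x ∈ A i
      · constructor
        · intro hj
          obtain rfl := hA i j x hx hj
          exact (k3 x).1 hj
        · intro hj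
          obtain rfl := hB i j _ ((k3 x).1 hx) hj
          exact hx
      · rw [k1 x hx]; exact h3 j x
    · intro j hj x hx y hy
      rcases Finset.mem_insert.1 hj with rfl | hj
      · exact k5 x hx y hy
      · exact k4 x y (h4 j hj x hx y hy)

/-- A system of disjoint links `u q → w q` between the clusters of the partition `P`, where the
link `q` may pass through a vertex `mid q` outside all clusters. -/
structure IsLinkSystem {α ι Q : Type*} (G : α → α → Prop) (P : α → Option ι) (src dst : Q → ι)
    (mid : Q → Option α) (u w : Q → α) : Prop where
  u_inj : Function.Injective u
  w_inj : Function.Injective w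
  u_ne_w : ∀ q q', u q ≠ w q'
  part_u : ∀ q, P (u q) = some (src q)
  part_w : ∀ q, P (w q) = some (dst q)
  part_mid : ∀ q x, mid q = some x → P x = none
  mid_inj : ∀ q q' x, mid q = some x → mid q' = some x → q = q'
  exists_mid : ∀ x, P x = none → ∃ q, mid q = some x
  edge : ∀ q, mid q = none → G (u q) (w q)
  edge_left : ∀ q x, mid q = some x → G (u q) x
  edge_right : ∀ q x, mid q = some x → G x (w q)

open Classical in
/-- The vertices of the cluster `i` not used by `u`. -/
noncomputable def freePart {α ι Q : Type*} [Fintype α] (P : α → Option ι) (u : Q → α) (i : ι) :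
    Finset α :=
  Finset.univ.filter fun v => P v = some i ∧ ∀ q, u q ≠ v

lemma mem_freePart {α ι Q : Type*} [Fintype α] {P : α → Option ι} {u : Q → α} {i : ι} {v : α} :
    v ∈ freePart P u i ↔ P v = some i ∧ ∀ q, u q ≠ v := by
  simp [freePart]

open Classical in
lemma card_freePart {α ι Q : Type*} [Fintype α] [Fintype Q] {P : α → Option ι} {u : Q → α}
    {src : Q → ι} (hu : Function.Injective u) (hsrc : ∀ q, P (u q) = some (src q)) (i : ι) :
    (freePart P u i).card + (Finset.univ.filter fun q => src q = i).card =
      (Finset.univ.filter fun v => P v = some i).card := by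
  rw [← Finset.card_image_of_injective (Finset.univ.filter fun q => src q = i) hu,
    ← Finset.card_union_of_disjoint]
  · congr 1
    ext v
    simp only [Finset.mem_union, mem_freePart, Finset.mem_image, Finset.mem_filter,
      Finset.mem_univ, true_and]
    constructor
    · rintro (h | ⟨q, rfl, rfl⟩)
      · exact h.1
      · exact hsrc q
    · intro h
      by_cases hq : ∃ q, u q = v
      · obtain ⟨q, rfl⟩ := hq
        exact Or.inr ⟨q, Option.some.inj ((hsrc q).symm.trans h), rfl⟩
      · exact Or.inl ⟨h, fun q hqv => hq ⟨q, hqv⟩⟩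
  · rw [Finset.disjoint_left]
    intro v hv hv'
    obtain ⟨q, _, rfl⟩ := Finset.mem_image.1 hv'
    exact (mem_freePart.1 hv).2 q rfl

/-- A link system and matchings between the remaining vertices of the clusters combine to a
`1`-factor. -/
lemma IsLinkSystem.exists_perm {α ι Q : Type*} [Fintype α] {G : α → α → Prop} {P : α → Option ι}
    {src dst : Q → ι} {mid : Q → Option α} {u w : Q → α} (h : IsLinkSystem G P src dst mid u w)
    (ρ : Equiv.Perm ι)
    (hM : ∀ i, ∃ f : α → α, (∀ a ∈ freePart P u i, f a ∈ freePart P w (ρ i) ∧ G a (f a)) ∧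
      ∀ a ∈ freePart P u i, ∀ a' ∈ freePart P u i, f a = f a' → a = a') :
    ∃ σ : Equiv.Perm α, (∀ v, G v (σ v)) ∧
      (∀ i v, v ∈ freePart P u i ↔ σ v ∈ freePart P w (ρ i)) ∧
      (∀ q, mid q = none → σ (u q) = w q) ∧
      ∀ q x, mid q = some x → σ (u q) = x ∧ σ x = w q := by
  choose M hM hMinj using hM
  let S : α → α → Prop := fun v y => (∃ i, v ∈ freePart P u i ∧ y = M i v) ∨
    (∃ q, v = u q ∧ mid q = none ∧ y = w q) ∨ (∃ q x, v = u q ∧ mid q = some x ∧ y = x) ∨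
    ∃ q, mid q = some v ∧ y = w q
  have total : ∀ v, ∃ y, S v y := by
    intro v
    by_cases hq : ∃ q, u q = v
    · obtain ⟨q, rfl⟩ := hq
      rcases hm : mid q with _ | x
      · exact ⟨w q, Or.inr (Or.inl ⟨q, rfl, hm, rfl⟩)⟩
      · exact ⟨x, Or.inr (Or.inr (Or.inl ⟨q, x, rfl, hm, rfl⟩))⟩
    · rcases hv : P v with _ | i
      · obtain ⟨q, hm⟩ := h.exists_mid v hv
        exact ⟨w q, Or.inr (Or.inr (Or.inr ⟨q, hm, rfl⟩))⟩
      · exact ⟨M i v, Or.inl ⟨i, mem_freePart.2 ⟨hv, fun q hqv => hq ⟨q, hqv⟩⟩, rfl⟩⟩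
  have hMw : ∀ i v, v ∈ freePart P u i → P (M i v) = some (ρ i) ∧ ∀ q, w q ≠ M i v :=
    fun i v hv => mem_freePart.1 (hM i v hv).1
  choose f hf using total
  have hedge : ∀ v, G v (f v) := by
    intro v
    rcases hf v with ⟨i, hv, hy⟩ | ⟨q, hv, hm, hy⟩ | ⟨q, x, hv, hm, hy⟩ | ⟨q, hm, hy⟩ <;> rw [hy]
    · exact (hM i v hv).2
    · rw [hv]; exact h.edge q hm
    · rw [hv]; exact h.edge_left q x hm
    · exact h.edge_right q v hm
  have hinj : Function.Injective f := by
    intro v v' hvv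
    have h' := hf v'
    rw [← hvv] at h'
    rcases hf v with ⟨i, hv, hy⟩ | ⟨q, hv, hm, hy⟩ | ⟨q, x, hv, hm, hy⟩ | ⟨q, hm, hy⟩ <;>
    rcases h' with ⟨i', hv', hy'⟩ | ⟨q', hv', hm', hy'⟩ | ⟨q', x', hv', hm', hy'⟩ |
      ⟨q', hm', hy'⟩ <;> have hyy := hy.symm.trans hy'
    · have h1 := (hMw i v hv).1
      rw [hyy, (hMw i' v' hv').1] at h1
      obtain rfl := ρ.injective (Option.some.inj h1)
      exact hMinj _ v hv v' hv' hyy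
    · exact absurd hyy.symm ((hMw i v hv).2 q')
    · have h1 := (hMw i v hv).1
      rw [hyy, h.part_mid q' x' hm'] at h1
      cases h1
    · exact absurd hyy.symm ((hMw i v hv).2 q')
    · exact absurd hyy ((hMw i' v' hv').2 q)
    · rw [hv, hv', h.w_inj hyy]
    · have h1 := h.part_w q
      rw [hyy, h.part_mid q' x' hm'] at h1
      cases h1
    · rw [h.w_inj hyy, hm'] at hm
      cases hm
    · have h1 := (hMw i' v' hv').1
      rw [← hyy, h.part_mid q x hm] at h1
      cases h1
    · have h1 := h.part_w q'
      rw [← hyy, h.part_mid q x hm] at h1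
      cases h1
    · rw [hv, hv', h.mid_inj q q' x hm (hyy ▸ hm')]
    · have h1 := h.part_w q'
      rw [← hyy, h.part_mid q x hm] at h1
      cases h1
    · exact absurd hyy ((hMw i' v' hv').2 q)
    · rw [h.w_inj hyy, hm'] at hm
      cases hm
    · have h1 := h.part_w q
      rw [hyy, h.part_mid q' x' hm'] at h1
      cases h1
    · rw [h.w_inj hyy, hm'] at hm
      exact (Option.some.inj hm).symm
  have hu : ∀ q i, u q ∉ freePart P u i := fun q i hq => (mem_freePart.1 hq).2 q rfl
  refine ⟨Equiv.ofBijective f (Finite.injective_iff_bijective.1 hinj), hedge, ?_, ?_, ?_⟩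
  · intro i v
    rw [Equiv.ofBijective_apply]
    rcases hf v with ⟨j, hv, hy⟩ | ⟨q, hv, hm, hy⟩ | ⟨q, x, hv, hm, hy⟩ | ⟨q, hm, hy⟩
    · have hj : ∀ i, i = j → (v ∈ freePart P u i ↔ f v ∈ freePart P w (ρ i)) := by
        rintro _ rfl
        rw [hy]
        exact iff_of_true hv (hM _ v hv).1
      constructor
      · intro hi
        refine (hj i ?_).1 hi
        exact Option.some.inj ((mem_freePart.1 hi).1.symm.trans (mem_freePart.1 hv).1)
      · intro hi
        refine (hj i ?_).2 hi
        rw [hy] at hi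
        exact ρ.injective (Option.some.inj ((mem_freePart.1 hi).1.symm.trans (hMw j v hv).1))
    · rw [hy, hv]
      exact iff_of_false (hu q i) fun hq => (mem_freePart.1 hq).2 q rfl
    · rw [hy, hv]
      refine iff_of_false (hu q i) fun hq => ?_
      have h1 := (mem_freePart.1 hq).1
      rw [h.part_mid q x hm] at h1
      cases h1
    · rw [hy]
      refine iff_of_false (fun hq => ?_) fun hq => (mem_freePart.1 hq).2 q rfl
      have h1 := (mem_freePart.1 hq).1
      rw [h.part_mid q v hm] at h1
      cases h1
  · intro q hm
    rw [Equiv.ofBijective_apply]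
    rcases hf (u q) with ⟨j, hv, hy⟩ | ⟨q', hv, hm', hy⟩ | ⟨q', x, hv, hm', hy⟩ | ⟨q', hm', hy⟩
    · exact absurd hv (hu q j)
    · rw [hy, h.u_inj hv]
    · rw [h.u_inj hv, hm'] at hm
      cases hm
    · have h1 := h.part_u q
      rw [h.part_mid q' _ hm'] at h1
      cases h1
  · intro q x hm
    simp only [Equiv.ofBijective_apply]
    constructor
    · rcases hf (u q) with ⟨j, hv, hy⟩ | ⟨q', hv, hm', hy⟩ | ⟨q', x', hv, hm', hy⟩ | ⟨q', hm', hy⟩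
      · exact absurd hv (hu q j)
      · rw [h.u_inj hv, hm'] at hm
        cases hm
      · rw [h.u_inj hv, hm'] at hm
        exact hy.trans (Option.some.inj hm)
      · have h1 := h.part_u q
        rw [h.part_mid q' _ hm'] at h1
        cases h1
    · have hx := h.part_mid q x hm
      rcases hf x with ⟨j, hv, hy⟩ | ⟨q', hv, hm', hy⟩ | ⟨q', x', hv, hm', hy⟩ | ⟨q', hm', hy⟩
      · rw [(mem_freePart.1 hv).1] at hx
        cases hx
      · rw [hv, h.part_u] at hx
        cases hx
      · rw [hv, h.part_u] at hx
        cases hx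
      · rw [hy, h.mid_inj q' q x hm' hm]

open Classical in
/-- If a balanced link system connects the clusters, then the links can be completed to a
Hamilton cycle using edges between consecutive clusters. -/
theorem IsLinkSystem.exists_isHamCycle {α ι Q : Type*} [Fintype α] [Fintype ι] [Fintype Q]
    {G : α → α → Prop} {P : α → Option ι} {src dst : Q → ι} {mid : Q → Option α} {u w : Q → α}
    (h : IsLinkSystem G P src dst mid u w) (ρ : Equiv.Perm ι) (N e D : ℕ)
    (hbal : ∀ i, (Finset.univ.filter fun q => src q = i).card =
      (Finset.univ.filter fun q => dst q = ρ i).card)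
    (hN : ∀ i, (Finset.univ.filter fun v => P v = some i).card = N)
    (hQ : 2 * Fintype.card Q < N) (hD : 8 * e + 8 ≤ D)
    (hout : ∀ i, ∀ a ∈ freePart P u i,
      D ≤ ((freePart P w (ρ i)).filter (fun b => G a b)).card)
    (hin : ∀ i, ∀ b ∈ freePart P w (ρ i),
      D ≤ ((freePart P u i).filter (fun a => G a b)).card)
    (hreg : ∀ i, ∀ X ⊆ freePart P u i, ∀ Y ⊆ freePart P w (ρ i), e ≤ X.card → e ≤ Y.card →
      ∃ x ∈ X, ∃ y ∈ Y, G x y)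
    (hconn : ∀ C : ι → Prop, (∀ i, C i ↔ C (ρ i)) → (∀ q, C (src q) ↔ C (dst q)) →
      ∀ i j, C i → C j) :
    ∃ σ : Equiv.Perm α, IsHamCycle G σ := by
  have hcu := card_freePart h.u_inj h.part_u
  have hcw := card_freePart h.w_inj h.part_w
  obtain ⟨σ, s1, s2, s3, s4⟩ := h.exists_perm ρ fun i => exists_matching e D (by omega) (by
    have h1 := hcu i
    have h2 := hcw (ρ i)
    rw [hN] at h1 h2
    have h3 := hbal i
    omega) (hout i) (hin i) (hreg i)
  obtain ⟨τ, t1, t2, t3, t4⟩ := exists_perm_merge_family (A := freePart P u)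
    (B := fun i => freePart P w (ρ i)) e D hD
    (fun i j x hi hj => Option.some.inj ((mem_freePart.1 hi).1.symm.trans (mem_freePart.1 hj).1))
    (fun i j x hi hj => ρ.injective
      (Option.some.inj ((mem_freePart.1 hi).1.symm.trans (mem_freePart.1 hj).1)))
    hout hin hreg s2 s1
  have step : ∀ v, τ.SameCycle v (τ v) := fun v => ⟨1, by simp⟩
  have hu : ∀ q, τ (u q) = σ (u q) := fun q => t1 _ fun i hi => (mem_freePart.1 hi).2 q rfl
  have huw : ∀ q, τ.SameCycle (u q) (w q) := by
    intro q
    have h1 := step (u q)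
    rw [hu] at h1
    rcases hm : mid q with _ | x
    · rwa [s3 q hm] at h1
    · have h2 := step x
      rw [(s4 q x hm).1] at h1
      have hx : τ x = σ x := t1 x fun i hi => by
        have := (mem_freePart.1 hi).1
        rw [h.part_mid q x hm] at this
        cases this
      rw [hx, (s4 q x hm).2] at h2
      exact h1.trans h2
  have both : ∀ i, ∃ v, v ∈ freePart P u i ∧ v ∈ freePart P w i := by
    intro i
    by_contra hn
    push Not at hn
    have hdisj : Disjoint (freePart P u i) (freePart P w i) := Finset.disjoint_left.2 hn
    have hsub : freePart P u i ∪ freePart P w i ⊆ Finset.univ.filter fun v => P v = some i := by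
      intro v hv
      rcases Finset.mem_union.1 hv with hv | hv <;> simp [(mem_freePart.1 hv).1]
    have h1 := Finset.card_le_card hsub
    rw [Finset.card_union_of_disjoint hdisj, hN] at h1
    have h2 := hcu i
    have h3 := hcw i
    rw [hN] at h2 h3
    have h4 := Finset.card_le_univ (Finset.univ.filter fun q => src q = i)
    have h5 := Finset.card_le_univ (Finset.univ.filter fun q => dst q = i)
    omega
  choose c hcu' hcw' using both
  have hB : ∀ i, ∀ v ∈ freePart P w i, τ.SameCycle (c i) v := by
    have aux : ∀ i, ∀ v ∈ freePart P w i, ∃ y ∈ freePart P u (ρ.symm i), τ y = v := by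
      intro i v hv
      refine ⟨τ.symm v, ?_, by simp⟩
      rw [t3]
      simpa using hv
    intro i v hv
    obtain ⟨y, hy, rfl⟩ := aux i v hv
    obtain ⟨z, hz, hzc⟩ := aux i (c i) (hcw' i)
    have h1 := step z
    rw [hzc] at h1
    exact h1.symm.trans ((t4 _ z hz y hy).trans (step y))
  have hP : ∀ i v, P v = some i → τ.SameCycle (c i) v := by
    intro i v hv
    by_cases hq : ∃ q, u q = v
    · obtain ⟨q, rfl⟩ := hq
      exact hB i _ (mem_freePart.2 ⟨hv, fun q' hq' => h.u_ne_w q q' hq'.symm⟩)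
    · exact t4 i _ (hcu' i) v (mem_freePart.2 ⟨hv, fun q hqv => hq ⟨q, hqv⟩⟩)
  have hcc : ∀ i j, τ.SameCycle (c i) (c j) := by
    intro i j
    refine hconn (fun j => τ.SameCycle (c i) (c j)) (fun j => ?_) (fun q => ?_) i j
      (Equiv.Perm.SameCycle.refl _ _)
    · have h1 : τ.SameCycle (c j) (c (ρ j)) :=
        (step (c j)).trans (hB _ _ ((t3 j _).1 (hcu' j))).symm
      exact ⟨fun h => h.trans h1, fun h => h.trans h1.symm⟩
    · have h1 : τ.SameCycle (c (src q)) (c (dst q)) :=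
        (hP _ _ (h.part_u q)).trans ((huw q).trans (hP _ _ (h.part_w q)).symm)
      exact ⟨fun h => h.trans h1, fun h => h.trans h1.symm⟩
  have hall : ∀ v, ∃ i, τ.SameCycle (c i) v := by
    intro v
    rcases hv : P v with _ | i
    · obtain ⟨q, hm⟩ := h.exists_mid v hv
      refine ⟨src q, (hP _ _ (h.part_u q)).trans ?_⟩
      have := step (u q)
      rwa [hu, (s4 q v hm).1] at this
    · exact ⟨i, hP i v hv⟩
  refine ⟨τ, t2, fun v v' => ?_⟩
  obtain ⟨i, hi⟩ := hall v
  obtain ⟨j, hj⟩ := hall v'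
  exact hi.symm.trans ((hcc i j).trans hj)

/-- In an expanding digraph with a `1`-factor `ρ` and large indegrees, any two vertices are joined
by a walk alternating between backward steps along `ρ` and forward steps along edges. -/
lemma exists_shifted_walk {ι : Type*} [Fintype ι] {R : ι → ι → Prop} {c : ℝ} (hc : 0 < c)
    (hdeg : ∀ v, 2 * c * Fintype.card ι ≤ (inDeg R v : ℝ))
    (hexp : ∀ S : Set ι, S.Nonempty → (S.ncard : ℝ) ≤ (1 - c) * Fintype.card ι →
      (S.ncard : ℝ) + c * Fintype.card ι ≤ ((outNSet R S).ncard : ℝ))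
    (ρ : Equiv.Perm ι) (y z : ι) :
    ∃ v : ℕ → ι, v 0 = y ∧ v (Fintype.card ι) = z ∧
      ∀ m < Fintype.card ι, R (ρ.symm (v m)) (v (m + 1)) := by
  have hk : (0 : ℝ) < Fintype.card ι := by
    exact_mod_cast Fintype.card_pos_iff.2 ⟨y⟩
  have hck : 0 < c * Fintype.card ι := mul_pos hc hk
  refine exists_walk_of_expanding (fun y z => R (ρ.symm y) z) (fun S hS => ?_) y z
  have hS' : (ρ.symm '' S).ncard = S.ncard := Set.ncard_image_of_injective _ ρ.symm.injective
  have hout : {z | ∃ y ∈ S, R (ρ.symm y) z} = outNSet R (ρ.symm '' S) := by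
    ext z
    constructor
    · rintro ⟨y, hy, h⟩
      exact ⟨_, ⟨y, hy, rfl⟩, h⟩
    · rintro ⟨_, ⟨y, hy, rfl⟩, h⟩
      exact ⟨y, hy, h⟩
  rw [hout]
  by_cases hsmall : (S.ncard : ℝ) ≤ (1 - c) * Fintype.card ι
  · right
    have := hexp (ρ.symm '' S) (hS.image _) (by rwa [hS'])
    rw [hS'] at this
    exact_mod_cast (by linarith : (S.ncard : ℝ) < ((outNSet R (ρ.symm '' S)).ncard : ℝ))
  · left
    intro z
    by_contra hn
    push Not at hn
    have hdisj : Disjoint (ρ.symm '' S) (inN R z) := by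
      rw [Set.disjoint_left]
      rintro _ ⟨y, hy, rfl⟩ hyz
      exact hn y hy hyz
    have h1 := Set.ncard_union_eq hdisj
    have h2 := Set.ncard_le_ncard (Set.subset_univ (ρ.symm '' S ∪ inN R z))
    rw [h1, hS', Set.ncard_univ, Nat.card_eq_fintype_card] at h2
    have h3 : (S.ncard : ℝ) + (inN R z).ncard ≤ Fintype.card ι := by exact_mod_cast h2
    have h4 : 2 * c * Fintype.card ι ≤ ((inN R z).ncard : ℝ) := hdeg z
    linarith

open Classical in
/-- Requests for links extending prescribed ones, are balanced with respect to `ρ`, and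
connect everything. -/
lemma exists_balanced_requests {ι X : Type*} [Fintype ι] [Fintype X] {R : ι → ι → Prop}
    (ρ : Equiv.Perm ι)
    (hwalk : ∀ y z, ∃ v : ℕ → ι, v 0 = y ∧ v (Fintype.card ι) = z ∧
      ∀ m < Fintype.card ι, R (ρ.symm (v m)) (v (m + 1))) (a b : X → ι) :
    ∃ src dst : (X ⊕ {p : ι × ι // R (ρ.symm p.1) p.2}) × Fin (Fintype.card ι + 1) → ι,
      (∀ x, src (Sum.inl x, 0) = a x ∧ dst (Sum.inl x, 0) = b x) ∧
      (∀ q, (∀ x, q ≠ (Sum.inl x, 0)) → R (src q) (dst q)) ∧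
      (∀ i, (Finset.univ.filter fun q => src q = i).card =
        (Finset.univ.filter fun q => dst q = ρ i).card) ∧
      ∀ C : ι → Prop, (∀ i, C i ↔ C (ρ i)) → (∀ q, C (src q) ↔ C (dst q)) →
        ∀ i j, C i → C j := by
  choose W hW0 hW1 hW using hwalk
  let s : X ⊕ {p : ι × ι // R (ρ.symm p.1) p.2} → ι := Sum.elim (fun x => ρ (a x)) fun p => p.1.1
  let t : X ⊕ {p : ι × ι // R (ρ.symm p.1) p.2} → ι := Sum.elim b fun p => p.1.2
  let v : X ⊕ {p : ι × ι // R (ρ.symm p.1) p.2} → ℕ → ι := fun e m =>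
    if m = 0 then s e else W (t e) (s e) (m - 1)
  have v0 : ∀ e, v e 0 = s e := fun e => rfl
  have v1 : ∀ e, v e 1 = t e := fun e => hW0 _ _
  have vk : ∀ e, v e (Fintype.card ι + 1) = v e 0 := fun e => hW1 _ _
  have vs : ∀ e m, m < Fintype.card ι → R (ρ.symm (v e (m + 1))) (v e (m + 2)) :=
    fun e m hm => hW _ _ m hm
  refine ⟨fun q => ρ.symm (v q.1 q.2), fun q => v q.1 (q.2 + 1), ?_, ?_, ?_, ?_⟩
  · intro x
    simp [v0, v1, s, t]
  · rintro ⟨e, ⟨m, hm⟩⟩ hq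
    rcases m with _ | m
    · rcases e with x | p
      · exact absurd rfl (hq x)
      · simpa [v0, v1, s, t] using p.2
    · exact vs e m (by omega)
  · intro i
    rw [Finset.card_filter, Finset.card_filter, Fintype.sum_prod_type, Fintype.sum_prod_type]
    refine Finset.sum_congr rfl fun e _ => ?_
    have h1 := Finset.sum_range_succ (fun m => if v e m = ρ i then 1 else 0) (Fintype.card ι + 1)
    have h2 := Finset.sum_range_succ' (fun m => if v e m = ρ i then 1 else 0) (Fintype.card ι + 1)
    rw [vk] at h1
    rw [Fin.sum_univ_eq_sum_range (fun m => if v e (m + 1) = ρ i then 1 else 0),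
      ← Nat.add_right_cancel (h1.symm.trans h2),
      ← Fin.sum_univ_eq_sum_range (fun m => if v e m = ρ i then 1 else 0)]
    simp only [Equiv.symm_apply_eq]
  · intro C hρ hC
    have hT : ∀ y z, R (ρ.symm y) z → (C y → C z) := by
      intro y z hyz hy
      have h1 := hC (Sum.inr ⟨(y, z), hyz⟩, 0)
      simp only [Fin.val_zero, v0, v1, zero_add, s, t, Sum.elim_inr] at h1
      refine h1.1 ((hρ _).2 ?_)
      simpa
    intro i j hi
    have : ∀ m ≤ Fintype.card ι, C (W i j m) := by
      intro m
      induction m with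
      | zero => intro _; rwa [hW0]
      | succ m ih => intro hm; exact hT _ _ (hW i j m (by omega)) (ih (by omega))
    have h := this _ le_rfl
    rwa [hW1] at h

lemma exists_edge_of_epsRegular {α : Type*} {G : α → α → Prop} {ε : ℝ} {A B X Y : Set α}
    [Finite α] (h : EpsRegular ε G A B) (hε : ε ≤ dens G A B) (hX : X ⊆ A) (hY : Y ⊆ B)
    (hXA : ε * A.ncard < X.ncard) (hYB : ε * B.ncard < Y.ncard) : ∃ x ∈ X, ∃ y ∈ Y, G x y := by
  by_contra hn
  push Not at hn
  have h0 : eCnt G X Y = 0 := by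
    have : {p : α × α | p.1 ∈ X ∧ p.2 ∈ Y ∧ G p.1 p.2} = ∅ := by
      ext p
      simpa using hn p.1 |> fun h h1 h2 => h h1 _ h2
    rw [eCnt, this, Set.ncard_empty]
  have h1 := h X hX Y hY hXA hYB
  rw [show dens G X Y = 0 by simp [dens, h0], zero_sub, abs_neg] at h1
  exact absurd (lt_of_le_of_lt (le_abs_self _) h1) (not_lt.2 hε)

open Classical in
/-- Disjoint links realising given requests can be chosen greedily. -/
lemma exists_isLinkSystem {α ι Q : Type*} [Fintype α] [Fintype Q] {G : α → α → Prop}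
    (hG : IsOriented G) {P : α → Option ι} {src dst : Q → ι} {mid : Q → Option α}
    (part_mid : ∀ q x, mid q = some x → P x = none)
    (mid_inj : ∀ q q' x, mid q = some x → mid q' = some x → q = q')
    (exists_mid : ∀ x, P x = none → ∃ q, mid q = some x)
    (hne : ∀ q, mid q = none → src q ≠ dst q)
    (hedge : ∀ q, mid q = none → ∀ F : Finset α, F.card ≤ 2 * Fintype.card Q →
      ∃ u w, u ∉ F ∧ w ∉ F ∧ P u = some (src q) ∧ P w = some (dst q) ∧ G u w)
    (hleft : ∀ q x, mid q = some x → ∀ F : Finset α, F.card ≤ 2 * Fintype.card Q →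
      ∃ u, u ∉ F ∧ P u = some (src q) ∧ G u x)
    (hright : ∀ q x, mid q = some x → ∀ F : Finset α, F.card ≤ 2 * Fintype.card Q →
      ∃ w, w ∉ F ∧ P w = some (dst q) ∧ G x w) :
    ∃ u w : Q → α, IsLinkSystem G P src dst mid u w := by
  obtain ⟨u, w, h1, h2, h3, h4⟩ := exists_disjoint_pairs
    (fun q u w => P u = some (src q) ∧ P w = some (dst q) ∧ (mid q = none → G u w) ∧
      ∀ x, mid q = some x → G u x ∧ G x w) (by
    intro q F hF
    rcases hm : mid q with _ | x
    · obtain ⟨u, w, hu, hw, hPu, hPw, huw⟩ := hedge q hm F hF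
      refine ⟨u, w, hu, hw, ?_, hPu, hPw, fun _ => huw, by simp⟩
      rintro rfl
      exact hne q hm (Option.some.inj (hPu.symm.trans hPw))
    · obtain ⟨u, hu, hPu, hux⟩ := hleft q x hm F hF
      obtain ⟨w, hw, hPw, hxw⟩ := hright q x hm F hF
      refine ⟨u, w, hu, hw, ?_, hPu, hPw, by simp, ?_⟩
      · rintro rfl
        exact hG _ _ hux hxw
      · intro x' hx'
        obtain rfl := Option.some.inj hx'
        exact ⟨hux, hxw⟩)
  exact ⟨u, w, h1, h2, h3, fun q => (h4 q).1, fun q => (h4 q).2.1, part_mid, mid_inj, exists_mid,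
    fun q => (h4 q).2.2.1, fun q x hx => ((h4 q).2.2.2 x hx).1,
    fun q x hx => ((h4 q).2.2.2 x hx).2⟩

/-- A vertex set larger than a finite set is not contained in it. -/
lemma exists_mem_notMem_of_card_lt_ncard {α : Type*} {S : Set α} {F : Finset α}
    (h : F.card < S.ncard) : ∃ x ∈ S, x ∉ F := by
  by_contra hn
  push Not at hn
  have h1 := Set.ncard_le_ncard (show S ⊆ (F : Set α) from hn) F.finite_toSet
  rw [Set.ncard_coe_finset] at h1
  omega

open Classical in
/-- Large degree into a cluster persists after removing the vertices of a link system. -/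
lemma le_card_filter_freePart {α ι Q : Type*} [Fintype α] [Fintype Q] {P : α → Option ι}
    {u : Q → α} {i : ι} {p : α → Prop} {D : ℕ}
    (h : D + Fintype.card Q ≤ ({v | p v} ∩ {v | P v = some i}).ncard) :
    D ≤ ((freePart P u i).filter p).card := by
  have hsub : {v | p v} ∩ {v | P v = some i} ⊆
      (((freePart P u i).filter p ∪ Finset.univ.image u : Finset α) : Set α) := by
    rintro v ⟨hv, hvP⟩
    by_cases hq : ∃ q, u q = v
    · obtain ⟨q, rfl⟩ := hq
      simp
    · simp only [Finset.coe_union, Set.mem_union, Finset.mem_coe, Finset.mem_filter]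
      exact Or.inl ⟨mem_freePart.2 ⟨hvP, fun q hqv => hq ⟨q, hqv⟩⟩, hv⟩
  have h1 := Set.ncard_le_ncard hsub (Finset.finite_toSet _)
  rw [Set.ncard_coe_finset] at h1
  have h2 := Finset.card_union_le ((freePart P u i).filter p) (Finset.univ.image u)
  have h3 : (Finset.univ.image u).card ≤ Fintype.card Q := Finset.card_image_le
  omega

open Classical in
/-- The blow-up of an expanding oriented graph with a `1`-factor, together with few exceptional
vertices, has a Hamilton cycle. -/
theorem exists_isHamCycle_of_regular {ι α : Type*} [Fintype ι] [Fintype α] {c d ε : ℝ} {N : ℕ}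
    (hc0 : 0 < c) (hc1 : c < 1) (hd0 : 0 < d) (hd1 : d ≤ 1) (hε0 : 0 < ε) (hε : ε ≤ d / 64)
    {R : ι → ι → Prop} (hR : IsOriented R)
    (hdeg : ∀ v, 2 * c * Fintype.card ι ≤ (inDeg R v : ℝ))
    (hexp : ∀ S : Set ι, S.Nonempty → (S.ncard : ℝ) ≤ (1 - c) * Fintype.card ι →
      (S.ncard : ℝ) + c * Fintype.card ι ≤ ((outNSet R S).ncard : ℝ))
    (ρ : Equiv.Perm ι) (hρ : ∀ i, R i (ρ i)) {G : α → α → Prop} (hG : IsOriented G)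
    {P : α → Option ι} (hN : ∀ i, {x | P x = some i}.ncard = N)
    (hexc : ∀ x, P x = none →
      (∃ i, c * N < ((inN G x ∩ {y | P y = some i}).ncard : ℝ)) ∧
      ∃ i, c * N < ((outN G x ∩ {y | P y = some i}).ncard : ℝ))
    (hsuper : ∀ i, SuperRegular ε d G {x | P x = some i} {x | P x = some (ρ i)})
    (hreg : ∀ i j, R i j → EpsRegular ε G {x | P x = some i} {x | P x = some j} ∧
      dens G {x | P x = some i} {x | P x = some j} = d)
    (hU : 32 * ({x | P x = none}.ncard : ℝ) * (Fintype.card ι + 1) ≤ c * d * N)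
    (hk : 32 * (Fintype.card ι : ℝ) ^ 2 * (Fintype.card ι + 1) + 64 ≤ c * d * N) :
    ∃ σ : Equiv.Perm α, IsHamCycle G σ := by
  choose a ha using fun x : {x // P x = none} => (hexc x x.2).1
  choose b hb using fun x : {x // P x = none} => (hexc x x.2).2
  obtain ⟨src, dst, hx0, hedge, hbal, hconn⟩ := exists_balanced_requests (R := R) ρ
    (exists_shifted_walk hc0 hdeg hexp ρ) a b
  let Q := ({x // P x = none} ⊕ {p : ι × ι // R (ρ.symm p.1) p.2}) × Fin (Fintype.card ι + 1)
  have hQ : 16 * (Fintype.card Q : ℝ) ≤ c * d * N := by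
    have h1 : Fintype.card Q = (Fintype.card {x // P x = none} +
        Fintype.card {p : ι × ι // R (ρ.symm p.1) p.2}) * (Fintype.card ι + 1) := by
      simp only [Q, Fintype.card_prod, Fintype.card_sum, Fintype.card_fin]
    have h2 : Fintype.card {x // P x = none} = {x | P x = none}.ncard := by
      rw [← Nat.card_eq_fintype_card]
      rfl
    have h3 : Fintype.card {p : ι × ι // R (ρ.symm p.1) p.2} ≤ Fintype.card ι ^ 2 := by
      refine (Fintype.card_subtype_le _).trans ?_
      rw [Fintype.card_prod, sq]
    have h4 : Fintype.card Q ≤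
        ({x | P x = none}.ncard + Fintype.card ι ^ 2) * (Fintype.card ι + 1) := by
      rw [h1, h2]
      gcongr
    have h5 : (Fintype.card Q : ℝ) ≤
        (({x | P x = none}.ncard : ℝ) + (Fintype.card ι : ℝ) ^ 2) * (Fintype.card ι + 1) := by
      exact_mod_cast h4
    nlinarith
  have hcd : c * d * N ≤ d * N := by
    have : (0 : ℝ) ≤ d * N := by positivity
    nlinarith
  have hcd' : c * d * N ≤ c * N := by
    have : (0 : ℝ) ≤ c * N := by positivity
    nlinarith
  have hdN : d * N ≤ N := mul_le_of_le_one_left (by positivity) hd1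
  have hεN : 64 * (ε * N) ≤ d * N := by
    have : (0 : ℝ) ≤ N := by positivity
    nlinarith
  have h64 : (64 : ℝ) ≤ c * d * N := le_trans (by nlinarith [show
    (0 : ℝ) ≤ (Fintype.card ι : ℝ) ^ 2 * (Fintype.card ι + 1) by positivity]) hk
  let mid : Q → Option α := fun q =>
    Sum.elim (fun x => if q.2 = 0 then some x.1 else none) (fun _ => none) q.1
  have hmid : ∀ q x, mid q = some x → ∃ y : {x // P x = none}, y.1 = x ∧ q = (Sum.inl y, 0) := by
    rintro ⟨y | p, m⟩ x hq
    · by_cases hm : m = 0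
      · exact ⟨y, by simpa [mid, hm] using hq, by rw [hm]⟩
      · simp [mid, hm] at hq
    · simp [mid] at hq
  have hmid0 : ∀ y, mid (Sum.inl y, 0) = some y.1 := fun y => by simp [mid]
  have hRq : ∀ q, mid q = none → R (src q) (dst q) := by
    refine fun q hq => hedge q fun x hx => ?_
    rw [hx, hmid0] at hq
    cases hq
  obtain ⟨u, w, huw⟩ : ∃ u w : Q → α, IsLinkSystem G P src dst mid u w := by
    refine exists_isLinkSystem hG ?_ ?_ ?_ ?_ ?_ ?_ ?_
    · intro q x hq
      obtain ⟨y, rfl, _⟩ := hmid q x hq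
      exact y.2
    · intro q q' x hq hq'
      obtain ⟨y, rfl, rfl⟩ := hmid q x hq
      obtain ⟨y', hy, rfl⟩ := hmid q' _ hq'
      rw [Subtype.ext hy]
    · exact fun x hx => ⟨(Sum.inl ⟨x, hx⟩, 0), hmid0 _⟩
    · intro q hq h
      have := hRq q hq
      rw [h] at this
      exact hR _ _ this this
    · intro q hq F hF
      obtain ⟨h1, h2⟩ := hreg _ _ (hRq q hq)
      have hlarge : ∀ i, ε * ({x | P x = some i}.ncard : ℝ) <
          (({x | P x = some i} \ F).ncard : ℝ) := by
        intro i
        have h3 := Set.le_ncard_sdiff (F : Set α) {x | P x = some i}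
        rw [Set.ncard_coe_finset, hN] at h3
        rw [hN]
        have h4 : (N : ℝ) ≤ ({x | P x = some i} \ (F : Set α)).ncard + 2 * Fintype.card Q := by
          exact_mod_cast (by omega :
            N ≤ ({x | P x = some i} \ (F : Set α)).ncard + 2 * Fintype.card Q)
        linarith
      obtain ⟨u, hu, w, hw, huw⟩ := exists_edge_of_epsRegular h1 (by rw [h2]; linarith)
        Set.sdiff_subset Set.sdiff_subset (hlarge _) (hlarge _)
      exact ⟨u, w, hu.2, hw.2, hu.1, hw.1, huw⟩
    · intro q x hq F hF
      obtain ⟨y, rfl, rfl⟩ := hmid q x hq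
      have h1 := ha y
      rw [(hx0 y).1]
      have hF' : (F.card : ℝ) ≤ 2 * Fintype.card Q := by exact_mod_cast hF
      obtain ⟨u, hu, huF⟩ := exists_mem_notMem_of_card_lt_ncard (F := F)
        (S := inN G y ∩ {z | P z = some (a y)}) (by exact_mod_cast (by linarith :
          (F.card : ℝ) < (inN G y ∩ {z | P z = some (a y)}).ncard))
      exact ⟨u, huF, hu.2, hu.1⟩
    · intro q x hq F hF
      obtain ⟨y, rfl, rfl⟩ := hmid q x hq
      have h1 := hb y
      rw [(hx0 y).2]
      have hF' : (F.card : ℝ) ≤ 2 * Fintype.card Q := by exact_mod_cast hF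
      obtain ⟨u, hu, huF⟩ := exists_mem_notMem_of_card_lt_ncard (F := F)
        (S := outN G y ∩ {z | P z = some (b y)}) (by exact_mod_cast (by linarith :
          (F.card : ℝ) < (outN G y ∩ {z | P z = some (b y)}).ncard))
      exact ⟨u, huF, hu.2, hu.1⟩
  have hfloor : ((⌊ε * N⌋₊ : ℕ) : ℝ) ≤ ε * N := Nat.floor_le (by positivity)
  have hcast : ∀ m : ℕ, (d - ε) * N ≤ (m : ℝ) →
      8 * (⌊ε * N⌋₊ + 1) + 8 + Fintype.card Q ≤ m := by
    intro m hm
    have : (8 * (⌊ε * N⌋₊ + 1) + 8 + Fintype.card Q : ℝ) ≤ m := by nlinarith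
    exact_mod_cast this
  refine huw.exists_isHamCycle ρ N (⌊ε * N⌋₊ + 1) (8 * (⌊ε * N⌋₊ + 1) + 8) hbal ?_ ?_ le_rfl ?_ ?_
    ?_ hconn
  · intro i
    rw [← hN i, ← Set.ncard_coe_finset]
    simp
  · have : (2 * Fintype.card Q : ℝ) < N := by linarith
    exact_mod_cast this
  · intro i v hv
    refine le_card_filter_freePart (hcast _ ?_)
    have := (hsuper i).2.1 v (mem_freePart.1 hv).1
    rwa [hN] at this
  · intro i v hv
    refine le_card_filter_freePart (hcast _ ?_)
    have := (hsuper i).2.2 v (mem_freePart.1 hv).1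
    rwa [hN] at this
  · intro i X hX Y hY hXe hYe
    have hlt : ∀ Z : Finset α, ⌊ε * N⌋₊ + 1 ≤ Z.card → ε * N < ((Z : Set α).ncard : ℝ) := by
      intro Z hZ
      rw [Set.ncard_coe_finset]
      exact (Nat.lt_floor_add_one _).trans_le (by exact_mod_cast hZ)
    obtain ⟨h1, h2⟩ := hreg _ _ (hρ i)
    obtain ⟨x, hx, y, hy, hxy⟩ := exists_edge_of_epsRegular (X := (X : Set α)) (Y := (Y : Set α)) h1
      (by rw [h2]; linarith) (fun x hx => (mem_freePart.1 (hX hx)).1)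
      (fun x hx => (mem_freePart.1 (hY hx)).1) (by rw [hN]; exact hlt X hXe)
      (by rw [hN]; exact hlt Y hYe)
    exact ⟨x, hx, y, hy, hxy⟩

/-- Counting the vertices of a partition into clusters of equal size. -/
lemma ncard_none_add_mul {ι α : Type*} [Fintype ι] [Fintype α] {P : α → Option ι} {N : ℕ}
    (hN : ∀ i, {x | P x = some i}.ncard = N) :
    {x | P x = none}.ncard + Fintype.card ι * N = Fintype.card α := by
  classical
  have h := Finset.card_eq_sum_card_fiberwise (f := P) (s := Finset.univ) (t := Finset.univ)
    (fun x _ => by simp)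
  rw [Fintype.sum_option, Finset.card_univ] at h
  rw [h, ← Set.ncard_coe_finset, Finset.coe_filter]
  simp only [Finset.mem_univ, true_and]
  rw [Finset.sum_congr rfl fun i _ => (?_ : _ = N)]
  · simp
  · rw [← hN i, ← Set.ncard_coe_finset]
    simp

/-- **Lemma 5 (the non-extremal case).**
Under the hierarchy `1/n ≪ ε₀ ≪ 1/k ≪ ε ≪ d ≪ c ≪ 1`: if `R` is an oriented graph on `[k]`
with `δ⁰(R) ≥ 2ck`, expanding (`|N⁺(S)| ≥ |S| + ck` for all nonempty `S` with
`|S| ≤ (1-c)k`), `𝒞` (encoded by the permutation `ρ`) is a `1`-factor of `R`, `R*` is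
obtained from `R` by adding a set `U₀` of at most `ε₀ n` vertices each having an in- and an
outneighbour in `[k]`, and `G*` is an oriented graph on `n` vertices with vertex partition
`U₀, U₁, …, U_k` satisfying (i)–(iv), then `G*` has a Hamilton cycle. -/
theorem hamilton_cycle_nonextremal :
    ∀ c : ℝ, 0 < c → c < 1 →
    ∃ d₀ : ℝ, 0 < d₀ ∧ ∀ d : ℝ, 0 < d → d ≤ d₀ →
    ∃ ε₁ : ℝ, 0 < ε₁ ∧ ∀ ε : ℝ, 0 < ε → ε ≤ ε₁ →
    ∃ k₀ : ℕ, ∀ k : ℕ, k₀ ≤ k →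
    ∃ ε₂ : ℝ, 0 < ε₂ ∧ ∀ ε₀ : ℝ, 0 < ε₀ → ε₀ ≤ ε₂ →
    ∃ n₀ : ℕ, ∀ n : ℕ, n₀ ≤ n →
    -- the oriented graph `R` on `[k]`
    ∀ R : Fin k → Fin k → Prop, IsOriented R →
    (∀ v : Fin k, 2 * c * k ≤ (min (outDeg R v) (inDeg R v) : ℝ)) →
    (∀ S : Set (Fin k), S.Nonempty → (S.ncard : ℝ) ≤ (1 - c) * k →
      (S.ncard : ℝ) + c * k ≤ ((outNSet R S).ncard : ℝ)) →
    -- the 1-factor `𝒞` of `R`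
    ∀ ρ : Equiv.Perm (Fin k), (∀ i, R i (ρ i)) →
    -- `G*` and its vertex partition `U₀, U₁, …, U_k`
    ∀ Gstar : Fin n → Fin n → Prop, IsOriented Gstar →
    ∀ P : Fin n → Option (Fin k),
    ∀ U : Fin k → Set (Fin n), (∀ i, U i = cluster P i) →
    ∀ U₀ : Set (Fin n), U₀ = cluster0 P →
    ((U₀.ncard : ℝ) ≤ ε₀ * n) →
    -- `R*`: obtained from `R` by adding the vertices of `U₀` and some edges
    ∀ Rstar : (Fin k ⊕ Fin n) → (Fin k ⊕ Fin n) → Prop, IsOriented Rstar →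
    (∀ i j : Fin k, Rstar (Sum.inl i) (Sum.inl j) ↔ R i j) →
    (∀ x : Fin n, x ∉ U₀ → ∀ z, ¬ Rstar (Sum.inr x) z ∧ ¬ Rstar z (Sum.inr x)) →
    (∀ x : Fin n, x ∈ U₀ →
      (∃ i, Rstar (Sum.inr x) (Sum.inl i)) ∧ (∃ i, Rstar (Sum.inl i) (Sum.inr x))) →
    -- (i) each `U_i` is independent
    (∀ x y : Fin n, P x = P y → ¬ Gstar x y) →
    -- (ii) edges of the 1-factor give super-regular pairs, edges of `R` give ε-regular
    -- pairs of density `d`, non-edges of `R` give empty pairs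
    (∀ i : Fin k, SuperRegular ε d Gstar (U i) (U (ρ i))) →
    (∀ i j : Fin k, R i j →
      EpsRegular ε Gstar (U i) (U j) ∧ dens Gstar (U i) (U j) = d) →
    (∀ i j : Fin k, ¬ R i j → eCnt Gstar (U i) (U j) = 0) →
    -- (iii) exceptional vertices have many neighbours in the clusters of their `R*`-neighbours
    (∀ x : Fin n, x ∈ U₀ → ∀ i : Fin k,
      (Rstar (Sum.inr x) (Sum.inl i) → c * (U i).ncard < ((outN Gstar x ∩ U i).ncard : ℝ)) ∧
      (Rstar (Sum.inl i) (Sum.inr x) → c * (U i).ncard < ((inN Gstar x ∩ U i).ncard : ℝ))) →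
    -- (iv) all clusters have the same size
    (∀ i j : Fin k, (U i).ncard = (U j).ncard) →
    ∃ σ : Equiv.Perm (Fin n), IsHamCycle Gstar σ := by
  intro c hc0 hc1
  refine ⟨1, one_pos, fun d hd0 hd1 => ⟨d / 64, by positivity, fun ε hε0 hε => ⟨1, fun k hk1 => ?_⟩⟩⟩
  have hk : (0 : ℝ) < k := by exact_mod_cast hk1
  have hcd : 0 < c * d := mul_pos hc0 hd0
  refine ⟨min (1 / 2) (c * d / (64 * k * (k + 1))), by positivity, fun ε₀ _ hε₀' =>
    ⟨⌈2 * k * (32 * (k : ℝ) ^ 2 * (k + 1) + 64) / (c * d)⌉₊, fun n hn => ?_⟩⟩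
  intro R hR hdeg hexp ρ hρ G hG P U hU U₀ hU₀ hsmall Rs _ _ _ hRs _ hsuper hreg _ hexc hsize
  obtain rfl := hU₀
  obtain rfl : U = cluster P := funext hU
  obtain ⟨N, hN⟩ : ∃ N, ∀ i, (cluster P i).ncard = N :=
    ⟨(cluster P ⟨0, hk1⟩).ncard, fun i => hsize i _⟩
  have hcount : ((cluster0 P).ncard : ℝ) + k * N = n := by
    have := ncard_none_add_mul (P := P) hN
    rw [Fintype.card_fin, Fintype.card_fin] at this
    exact_mod_cast this
  have hn0 : (0 : ℝ) ≤ n := Nat.cast_nonneg n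
  have hhalf : ε₀ * n ≤ 1 / 2 * n :=
    mul_le_mul_of_nonneg_right (hε₀'.trans (min_le_left _ _)) hn0
  have hn2 : (n : ℝ) ≤ 2 * k * N := by linarith
  refine exists_isHamCycle_of_regular hc0 hc1 hd0 hd1 hε0 hε hR ?_ ?_ ρ hρ hG hN ?_ hsuper hreg
    ?_ ?_
  · intro v
    rw [Fintype.card_fin]
    exact (le_min_iff.1 (hdeg v)).2
  · simpa using hexp
  · intro x hx
    obtain ⟨⟨i, hi⟩, j, hj⟩ := hRs x hx
    have h1 := (hexc x hx j).2 hj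
    have h2 := (hexc x hx i).1 hi
    rw [hN] at h1 h2
    exact ⟨⟨j, h1⟩, i, h2⟩
  · rw [Fintype.card_fin]
    have h1 : ε₀ * n ≤ c * d / (64 * k * (k + 1)) * (2 * k * N) :=
      mul_le_mul (hε₀'.trans (min_le_right _ _)) hn2 hn0 (by positivity)
    have h2 : c * d / (64 * k * (k + 1)) * (2 * k * N) * (32 * (k + 1)) = c * d * N := by
      field_simp
      ring
    have h3 : ((cluster0 P).ncard : ℝ) * (32 * (k + 1)) ≤ c * d * N := by
      rw [← h2]
      exact mul_le_mul_of_nonneg_right (hsmall.trans h1) (by positivity)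
    exact le_trans (le_of_eq (by rw [cluster0]; ring)) h3
  · rw [Fintype.card_fin]
    have h1 := (Nat.ceil_le.1 hn).trans hn2
    rw [div_le_iff₀ hcd] at h1
    refine le_of_mul_le_mul_left (a := 2 * (k : ℝ)) ?_ (by positivity)
    linarith

end ArxivOG
end

section
/- For every ε ∈ (0,1) there exist numbers M' = M'(ε) and n₀ = n₀(ε) such that the following holds. Let d ∈ [0,1] with ε ≤ d/2, let G be an oriented graph on n ≥ n₀ vertices, let V₀, V₁, …, V_k (k ≥ M') be a partition of V(G) with |V₀| ≤ εn and |V₁| = … = |V_k| = m, and let G' be a spanning subdigraph of G with d⁺_{G'}(x) > d⁺_G(x) − (d+ε)n and d⁻_{G'}(x) > d⁻_G(x) − (d+ε)n for all x, each G'[V_i] empty (i ≥ 1), and such that for all i ≠ j the bipartite graph of V_i–V_j edges of G' is ε-regular with density either 0 or at least d. Let R' be the reduced digraph on [k], with ij ∈ E(R') iff the bipartite graph of V_i–V_j edges of G' has density at least d. Then R' has a spanning oriented subgraph R such that: (a) δ⁺(R) ≥ (δ⁺(G)/n − (3ε+d))k; (b) δ⁻(R) ≥ (δ⁻(G)/n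 − (3ε+d))k; (c) for all disjoint sets S, T ⊆ [k] with e_G(S*, T*) ≥ 3dn², where S* = ∪_{i∈S} V_i and T* = ∪_{i∈T} V_i, one has e_R(S,T) > dk²; (d) for every set S ⊆ [k] with e_G(S*) ≥ 3dn² one has e_R(S) > dk². -/
open Set

namespace ArxivOG

variable {V : Type*}

open Classical in
theorem eCnt_eq_sum [Fintype V] (G : V → V → Prop) (A B : Set V) :
    (eCnt G A B : ℝ) = ∑ x, ∑ y, if x ∈ A ∧ y ∈ B ∧ G x y then (1 : ℝ) else 0 := by
  rw [eCnt, Set.ncard_eq_toFinset_card', Set.toFinset_ofPred, Finset.natCast_card_filter,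
    Fintype.sum_prod_type]

open Classical in
theorem ncard_eq_sum [Fintype V] (A : Set V) :
    (A.ncard : ℝ) = ∑ x, if x ∈ A then (1 : ℝ) else 0 := by
  rw [Set.ncard_eq_toFinset_card', ← Finset.natCast_card_filter]
  congr 2
  ext x
  simp

open Classical in
theorem outDeg_eq_sum [Fintype V] (G : V → V → Prop) (x : V) :
    (outDeg G x : ℝ) = ∑ y, if G x y then (1 : ℝ) else 0 :=
  ncard_eq_sum (outN G x)

theorem eCnt_flip [Fintype V] (G : V → V → Prop) (A B : Set V) :
    eCnt (flip G) B A = eCnt G A B := by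
  classical
  have h : (eCnt (flip G) B A : ℝ) = eCnt G A B := by
    rw [eCnt_eq_sum, eCnt_eq_sum, Finset.sum_comm]
    refine Finset.sum_congr rfl fun x _ => Finset.sum_congr rfl fun y _ => ?_
    simp only [flip, and_left_comm]
  exact_mod_cast h

theorem eCnt_le_mul [Fintype V] (G : V → V → Prop) (A B : Set V) :
    (eCnt G A B : ℝ) ≤ A.ncard * B.ncard := by
  classical
  rw [eCnt_eq_sum, ncard_eq_sum, ncard_eq_sum, Finset.sum_mul_sum]
  refine Finset.sum_le_sum fun x _ => Finset.sum_le_sum fun y _ => ?_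
  by_cases hx : x ∈ A <;> by_cases hy : y ∈ B <;> by_cases hG : G x y <;> simp [hx, hy, hG]

theorem eCnt_add_eCnt_le_mul [Fintype V] {G : V → V → Prop} (hG : IsOriented G) (A B : Set V) :
    (eCnt G A B : ℝ) + eCnt G B A ≤ A.ncard * B.ncard := by
  classical
  rw [← eCnt_flip G B A, eCnt_eq_sum, eCnt_eq_sum, ncard_eq_sum, ncard_eq_sum,
    Finset.sum_mul_sum, ← Finset.sum_add_distrib]
  refine Finset.sum_le_sum fun x _ => ?_
  rw [← Finset.sum_add_distrib]
  refine Finset.sum_le_sum fun y _ => ?_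
  have := hG x y
  by_cases hx : x ∈ A <;> by_cases hy : y ∈ B <;> by_cases h1 : G x y <;>
    by_cases h2 : G y x <;> simp_all [flip]

theorem eCnt_univ_right [Fintype V] (G : V → V → Prop) (A : Set V) [DecidablePred (· ∈ A)] :
    (eCnt G A univ : ℝ) = ∑ x, if x ∈ A then (outDeg G x : ℝ) else 0 := by
  classical
  rw [eCnt_eq_sum]
  refine Finset.sum_congr rfl fun x _ => ?_
  rw [outDeg_eq_sum]
  by_cases hx : x ∈ A <;> simp [hx]

theorem eCnt_univ_le [Fintype V] (G : V → V → Prop) (A B : Set V) :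
    (eCnt G A univ : ℝ) ≤ eCnt G A B + A.ncard * Bᶜ.ncard := by
  classical
  refine le_trans ?_ (add_le_add_right (eCnt_le_mul G A Bᶜ) _)
  rw [eCnt_eq_sum, eCnt_eq_sum, eCnt_eq_sum, ← Finset.sum_add_distrib]
  refine Finset.sum_le_sum fun x _ => ?_
  rw [← Finset.sum_add_distrib]
  refine Finset.sum_le_sum fun y _ => ?_
  by_cases hx : x ∈ A <;> by_cases hy : y ∈ B <;> by_cases hG : G x y <;> simp [hx, hy, hG]

/-- Passing to a subdigraph loses few edges if it decreases all outdegrees by little. -/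
theorem eCnt_le_of_outDeg [Fintype V] {G H : V → V → Prop} (hHG : ∀ x y, H x y → G x y)
    {c : ℝ} (hdeg : ∀ x, (outDeg G x : ℝ) - c ≤ outDeg H x) (A B : Set V) :
    (eCnt G A B : ℝ) ≤ eCnt H A B + Fintype.card V * c := by
  classical
  have h : ∀ x, (∑ y, if x ∈ A ∧ y ∈ B ∧ G x y then (1 : ℝ) else 0) ≤
      (∑ y, if x ∈ A ∧ y ∈ B ∧ H x y then (1 : ℝ) else 0) + c := by
    intro x
    have h1 := hdeg x
    rw [outDeg_eq_sum, outDeg_eq_sum] at h1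
    have h2 : (∑ y, if x ∈ A ∧ y ∈ B ∧ G x y then (1 : ℝ) else 0) +
        (∑ y, if H x y then (1 : ℝ) else 0) ≤
        (∑ y, if x ∈ A ∧ y ∈ B ∧ H x y then (1 : ℝ) else 0) +
        ∑ y, if G x y then (1 : ℝ) else 0 := by
      rw [← Finset.sum_add_distrib, ← Finset.sum_add_distrib]
      refine Finset.sum_le_sum fun y _ => ?_
      have := hHG x y
      by_cases hx : x ∈ A <;> by_cases hy : y ∈ B <;> by_cases h1 : G x y <;>
        by_cases h2 : H x y <;> simp_all
    linarith
  rw [eCnt_eq_sum, eCnt_eq_sum]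
  calc _ ≤ ∑ x, ((∑ y, if x ∈ A ∧ y ∈ B ∧ H x y then (1 : ℝ) else 0) + c) :=
        Finset.sum_le_sum fun x _ => h x
    _ = _ := by simp [Finset.sum_add_distrib]

theorem eCnt_finset [Fintype V] (G : V → V → Prop) [DecidableRel G] (S T : Finset V) :
    (eCnt G (S : Set V) (T : Set V) : ℝ) = ∑ i ∈ S, ∑ j ∈ T, if G i j then (1 : ℝ) else 0 := by
  classical
  rw [eCnt_eq_sum]
  trans ∑ x, if x ∈ S then ∑ y ∈ T, if G x y then (1 : ℝ) else 0 else 0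
  · refine Finset.sum_congr rfl fun x _ => ?_
    by_cases hx : x ∈ S <;> simp [hx, ite_and, Finset.sum_ite_mem, -Finset.sum_boole]
  · simp only [Finset.sum_ite_mem, Finset.univ_inter]

theorem eCnt_biUnion_cluster [Fintype V] {k : ℕ} (G : V → V → Prop) (P : V → Option (Fin k))
    (S T : Finset (Fin k)) :
    (eCnt G (⋃ i ∈ S, cluster P i) (⋃ i ∈ T, cluster P i) : ℝ) =
      ∑ i ∈ S, ∑ j ∈ T, (eCnt G (cluster P i) (cluster P j) : ℝ) := by
  classical
  have hmem : ∀ (S : Finset (Fin k)) (x : V),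
      (∑ i ∈ S, if x ∈ cluster P i then (1 : ℝ) else 0) =
        if x ∈ ⋃ i ∈ S, cluster P i then 1 else 0 := by
    intro S x
    by_cases hx : x ∈ ⋃ i ∈ S, cluster P i
    · rw [if_pos hx]
      obtain ⟨i, hi, hPi⟩ := mem_iUnion₂.1 hx
      rw [Finset.sum_eq_single_of_mem i hi, if_pos hPi]
      exact fun j _ hj => if_neg fun h => hj (Option.some_inj.1 (Eq.trans (Eq.symm h) hPi))
    · rw [if_neg hx]
      exact Finset.sum_eq_zero fun i hi => if_neg fun h => hx (mem_iUnion₂.2 ⟨i, hi, h⟩)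
  have hterm : ∀ (A B : Set V) (x y : V), (if x ∈ A ∧ y ∈ B ∧ G x y then (1 : ℝ) else 0) =
      (if x ∈ A then 1 else 0) * (if y ∈ B then 1 else 0) * (if G x y then 1 else 0) := by
    intro A B x y
    by_cases hx : x ∈ A <;> by_cases hy : y ∈ B <;> by_cases hG : G x y <;> simp [hx, hy, hG]
  simp only [eCnt_eq_sum, hterm, ← hmem]
  have hexp : ∀ x y : V, (∑ i ∈ S, if x ∈ cluster P i then (1 : ℝ) else 0) *
      (∑ j ∈ T, if y ∈ cluster P j then 1 else 0) * (if G x y then 1 else 0) =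
      ∑ e ∈ S ×ˢ T, (if x ∈ cluster P e.1 then 1 else 0) *
        (if y ∈ cluster P e.2 then 1 else 0) * (if G x y then 1 else 0) := by
    intro x y
    rw [Finset.sum_mul_sum, ← Finset.sum_product', Finset.sum_mul]
  simp only [hexp]
  rw [← Finset.sum_product', Finset.sum_comm]
  simp only [Finset.sum_product]

/-- A derandomized moment generating function bound: if each coordinate is `true` with
probability `p e` independently, some outcome does no worse than the expectation. -/
theorem exists_sum_exp_le {ι τ : Type*} [Fintype τ] [DecidableEq ι] (p : ι → ℝ)
    (hp0 : ∀ e, 0 ≤ p e) (hp1 : ∀ e, p e ≤ 1) (y : τ → ι → Bool → ℝ) (b : τ → ι → ℝ)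
    (h : ∀ t e, p e * Real.exp (y t e true) + (1 - p e) * Real.exp (y t e false)
      ≤ Real.exp (b t e))
    (s : Finset ι) (c : τ → ℝ) (hc : ∀ t, 0 ≤ c t) :
    ∃ x : ι → Bool, ∑ t, c t * Real.exp (∑ e ∈ s, y t e (x e)) ≤
      ∑ t, c t * Real.exp (∑ e ∈ s, b t e) := by
  induction s using Finset.induction_on generalizing c with
  | empty => exact ⟨fun _ => true, by simp⟩
  | insert e s he ih =>
    let F : Bool → ℝ := fun v =>
      ∑ t, c t * Real.exp (y t e v) * Real.exp (∑ e ∈ s, b t e)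
    have havg : p e * F true + (1 - p e) * F false ≤
        ∑ t, c t * Real.exp (∑ e ∈ insert e s, b t e) := by
      simp only [F, Finset.mul_sum, ← Finset.sum_add_distrib]
      refine Finset.sum_le_sum fun t _ => ?_
      rw [Finset.sum_insert he, Real.exp_add]
      have := mul_le_mul_of_nonneg_left (h t e)
        (mul_nonneg (hc t) (Real.exp_pos (∑ e ∈ s, b t e)).le)
      linarith
    obtain ⟨v, hv⟩ : ∃ v, F v ≤ ∑ t, c t * Real.exp (∑ e ∈ insert e s, b t e) := by
      by_contra! hcon
      have h1 := hcon true
      have h2 := hcon false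
      have h3 := hp0 e
      have h4 := hp1 e
      rcases h3.eq_or_lt with h5 | h5
      · rw [← h5] at havg
        linarith
      · nlinarith [mul_lt_mul_of_pos_left h1 h5,
          mul_le_mul_of_nonneg_left h2.le (sub_nonneg.2 h4)]
    obtain ⟨x, hx⟩ := ih (fun t => c t * Real.exp (y t e v))
      fun t => mul_nonneg (hc t) (Real.exp_pos _).le
    refine ⟨Function.update x e v, le_trans (le_of_eq ?_) (hx.trans hv)⟩
    refine Finset.sum_congr rfl fun t _ => ?_
    rw [Finset.sum_insert he, Real.exp_add, Function.update_self, mul_assoc]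
    congr 3
    refine Finset.sum_congr rfl fun f hf => ?_
    rw [Function.update_of_ne (by rintro rfl; exact he hf)]

theorem exp_average_le {p u v s b : ℝ} (hp0 : 0 ≤ p) (hp1 : p ≤ 1)
    (hs : s ≤ 1) (hu : |u| ≤ s) (hv : |v| ≤ s) (hmean : p * u + (1 - p) * v ≤ 0)
    (hb : s ^ 2 ≤ b) :
    p * Real.exp u + (1 - p) * Real.exp v ≤ Real.exp b := by
  have key : ∀ w : ℝ, |w| ≤ s → Real.exp w ≤ 1 + w + s ^ 2 := by
    intro w hw
    have h1 := (abs_le.1 (Real.abs_exp_sub_one_sub_id_le (hw.trans hs))).2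
    have h2 : w ^ 2 ≤ s ^ 2 := sq_le_sq' (abs_le.1 hw).1 (abs_le.1 hw).2
    linarith
  have h1 := mul_le_mul_of_nonneg_left (key u hu) hp0
  have h2 := mul_le_mul_of_nonneg_left (key v hv) (sub_nonneg.2 hp1)
  have h3 := Real.add_one_le_exp b
  nlinarith

theorem sum_sum_eq_sum_lt {κ : Type*} [Fintype κ] [LinearOrder κ] (f : κ → κ → ℝ) :
    ∑ i, ∑ j, f i j =
      ∑ e : κ × κ with e.1 < e.2, (f e.1 e.2 + f e.2 e.1) + ∑ i, f i i := by
  have h1 : ∑ e : κ × κ with e.1 < e.2, f e.2 e.1 = ∑ i, ∑ j, if j < i then f i j else 0 := by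
    rw [Finset.sum_filter, Fintype.sum_prod_type, Finset.sum_comm]
  have h2 : ∑ e : κ × κ with e.1 < e.2, f e.1 e.2 = ∑ i, ∑ j, if i < j then f i j else 0 := by
    rw [Finset.sum_filter, Fintype.sum_prod_type]
  have h3 : ∑ i, f i i = ∑ i, ∑ j, if i = j then f i j else 0 := by simp
  rw [Finset.sum_add_distrib, h1, h2, h3]
  simp only [← Finset.sum_add_distrib]
  refine Finset.sum_congr rfl fun i _ => Finset.sum_congr rfl fun j _ => ?_
  rcases lt_trichotomy i j with h | h | h
  · simp [h, h.not_gt, h.ne]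
  · simp [h]
  · simp [h, h.not_gt, h.ne']

/-- The moment generating function bound for a single pair of vertices, carrying edges of weights
`D` and `E` in the two directions. -/
theorem exp_choice_le {D E s A B q r : ℝ} (hD : 0 ≤ D) (hE : 0 ≤ E) (hDE : D + E ≤ 1)
    (hs0 : 0 < s) (hs1 : s ≤ 1) (hA : A = 0 ∨ A = 1) (hB : B = 0 ∨ B = 1)
    (hq : q = 1 ∨ q = 0 ∧ D = 0) (hr : r = 1 ∨ r = 0 ∧ E = 0) :
    D * Real.exp (-(s * (A * (q - D) + B * (0 - E)))) +
      (1 - D) * Real.exp (-(s * (A * (0 - D) + B * (r - E)))) ≤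
      Real.exp (s ^ 2 * (A + B)) := by
  by_cases h0 : A = 0 ∧ B = 0
  · simp [h0]
  have habs : ∀ w : ℝ, |w| ≤ 1 → |-(s * w)| ≤ s := by
    intro w hw
    rw [abs_neg, abs_mul, abs_of_pos hs0]
    exact mul_le_of_le_one_right hs0.le hw
  refine exp_average_le hD (by linarith) hs1 (habs _ ?_) (habs _ ?_) ?_ ?_
  · rw [abs_le]
    rcases hA with rfl | rfl <;> rcases hB with rfl | rfl <;> rcases hq with rfl | ⟨rfl, rfl⟩ <;>
      constructor <;> linarith
  · rw [abs_le]
    rcases hA with rfl | rfl <;> rcases hB with rfl | rfl <;> rcases hr with rfl | ⟨rfl, rfl⟩ <;>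
      constructor <;> linarith
  · have h1 : D * q = D := by rcases hq with rfl | ⟨rfl, rfl⟩ <;> simp
    have h2 : 0 ≤ (1 - D) * r - E := by rcases hr with rfl | ⟨rfl, rfl⟩ <;> linarith
    have h3 : 0 ≤ s * (B * ((1 - D) * r - E)) := by
      rcases hB with rfl | rfl
      · simp
      · simpa using mul_nonneg hs0.le h2
    linear_combination h3 - s * A * h1
  · refine le_mul_of_one_le_right (sq_nonneg s) ?_
    rcases hA with rfl | rfl <;> rcases hB with rfl | rfl <;> simp_all

/-- A digraph `Q` with edge weights `D` contains an oriented subgraph whose edge counts between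
prescribed pairs of vertex sets are almost as large as the corresponding sums of weights. -/
theorem exists_oriented_subgraph {κ τ : Type*} [Fintype κ] [LinearOrder κ] [Fintype τ]
    (D : κ → κ → ℝ) (hD0 : ∀ i j, 0 ≤ D i j) (hD1 : ∀ i j, D i j + D j i ≤ 1)
    (hDdiag : ∀ i, D i i = 0) (Q : κ → κ → Prop) (hQ : ∀ i j, ¬ Q i j → D i j = 0)
    (S T : τ → Finset κ) (s l : τ → ℝ) (hs0 : ∀ t, 0 < s t) (hs1 : ∀ t, s t ≤ 1)
    (hsum : ∑ t, Real.exp (s t ^ 2 * ((S t).card * (T t).card) - s t * l t) ≤ 1) :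
    ∃ R : κ → κ → Prop, (∀ i j, R i j → Q i j) ∧ IsOriented R ∧
      ∀ t, ∑ i ∈ S t, ∑ j ∈ T t, D i j - l t ≤
        eCnt R (S t : Set κ) (T t : Set κ) := by
  classical
  let a : τ → κ → κ → ℝ := fun t i j => if i ∈ S t ∧ j ∈ T t then 1 else 0
  have ha : ∀ t i j, a t i j = 0 ∨ a t i j = 1 := fun t i j => by
    by_cases h : i ∈ S t ∧ j ∈ T t
    · exact Or.inr (if_pos h)
    · exact Or.inl (if_neg h)
  have hsuma : ∀ t (f : κ → κ → ℝ),
      ∑ i, ∑ j, a t i j * f i j = ∑ i ∈ S t, ∑ j ∈ T t, f i j := by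
    intro t f
    have h : ∀ i, ∑ j, a t i j * f i j = if i ∈ S t then ∑ j ∈ T t, f i j else 0 := by
      intro i
      by_cases hi : i ∈ S t <;> simp [a, hi, Finset.sum_ite_mem]
    simp only [h, Finset.sum_ite_mem, Finset.univ_inter]
  let r : κ × κ → Bool → ℝ := fun e v => if Q e.1 e.2 ∧ v = true then 1 else 0
  let y : τ → κ × κ → Bool → ℝ := fun t e v =>
    - (s t * (a t e.1 e.2 * (r e v - D e.1 e.2) + a t e.2 e.1 * (r e.swap (!v) - D e.2 e.1)))
  let b : τ → κ × κ → ℝ := fun t e => s t ^ 2 * (a t e.1 e.2 + a t e.2 e.1)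
  have hy : ∀ t e, D e.1 e.2 * Real.exp (y t e true) + (1 - D e.1 e.2) * Real.exp (y t e false)
      ≤ Real.exp (b t e) := by
    rintro t ⟨i, j⟩
    have hQ' : ∀ i j, (if Q i j then (1 : ℝ) else 0) = 1 ∨
        (if Q i j then (1 : ℝ) else 0) = 0 ∧ D i j = 0 := by
      intro i j
      by_cases h : Q i j
      · simp [h]
      · simp [h, hQ i j h]
    have := exp_choice_le (hD0 i j) (hD0 j i) (hD1 i j) (hs0 t) (hs1 t) (ha t i j) (ha t j i)
      (hQ' i j) (hQ' j i)
    simpa [y, r, b] using this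
  obtain ⟨x, hx⟩ := exists_sum_exp_le (fun e : κ × κ => D e.1 e.2) (fun e => hD0 _ _)
    (fun e => by linarith [hD0 e.2 e.1, hD1 e.1 e.2]) y b hy
    (Finset.univ.filter fun e : κ × κ => e.1 < e.2) (fun t => Real.exp (-(s t * l t)))
    fun t => (Real.exp_pos _).le
  refine ⟨fun i j => Q i j ∧ (i < j ∧ x (i, j) = true ∨ j < i ∧ x (j, i) = false),
    fun i j h => h.1, ?_, fun t => ?_⟩
  · rintro i j ⟨-, ⟨h1, h2⟩ | ⟨h1, h2⟩⟩ ⟨-, ⟨h3, h4⟩ | ⟨h3, h4⟩⟩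
    · exact h1.not_gt h3
    · simp_all
    · simp_all
    · exact h1.not_gt h3
  have hbsum : ∀ t, ∑ e : κ × κ with e.1 < e.2, b t e ≤
      s t ^ 2 * ((S t).card * (T t).card) := by
    intro t
    simp only [b, ← Finset.mul_sum]
    refine mul_le_mul_of_nonneg_left ?_ (sq_nonneg _)
    have h1 := hsuma t fun _ _ => 1
    simp only [mul_one, Finset.sum_const, nsmul_eq_mul] at h1
    rw [← h1, sum_sum_eq_sum_lt]
    refine le_add_of_nonneg_right (Finset.sum_nonneg fun i _ => ?_)
    rcases ha t i i with h | h <;> simp [h]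
  have hle : ∑ t, Real.exp (-(s t * l t)) * Real.exp (∑ e : κ × κ with e.1 < e.2, b t e) ≤ 1 := by
    refine le_trans (Finset.sum_le_sum fun t _ => ?_) hsum
    rw [← Real.exp_add]
    exact Real.exp_le_exp.2 (by linarith [hbsum t])
  have hone := (Finset.single_le_sum (f := fun t => Real.exp (-(s t * l t)) *
    Real.exp (∑ e : κ × κ with e.1 < e.2, y t e (x e)))
    (fun t _ => (mul_pos (Real.exp_pos _) (Real.exp_pos _)).le) (Finset.mem_univ t)).trans
    (hx.trans hle)
  simp only [← Real.exp_add, Real.exp_le_one_iff] at hone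
  rw [eCnt_finset, ← hsuma, ← hsuma, sub_le_iff_le_add, ← sub_le_iff_le_add',
    ← Finset.sum_sub_distrib]
  simp only [← Finset.sum_sub_distrib, ← mul_sub]
  rw [sum_sum_eq_sum_lt]
  refine (add_le_of_nonpos_right (Finset.sum_nonpos fun i _ => by simp [hDdiag])).trans ?_
  refine le_of_mul_le_mul_left ?_ (hs0 t)
  rw [neg_add_nonpos_iff] at hone
  refine le_trans (le_of_eq ?_) hone
  rw [Finset.mul_sum]
  refine Finset.sum_congr rfl fun e he => ?_
  have he' := (Finset.mem_filter.1 he).2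
  simp only [y, r, he', he'.not_gt, true_and, false_and, or_false, false_or, Prod.fst_swap,
    Prod.snd_swap, Bool.not_eq_true', Prod.mk.eta]
  ring

theorem exists_forall_exp_sum_le_one {ε : ℝ} (hε : 0 < ε) : ∃ M : ℕ, 0 < M ∧ ∀ k : ℕ, M ≤ k →
    (2 ^ k * 2 ^ k) * Real.exp (-(ε ^ 2 / 16 * k ^ 2)) +
      (k * Real.exp (-(ε ^ 2 / 4 * k)) + k * Real.exp (-(ε ^ 2 / 4 * k))) ≤ (1 : ℝ) := by
  have hc : 0 < ε ^ 2 / 4 := by positivity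
  have h1 : Filter.Tendsto (fun k : ℕ => (ε ^ 2 / 4 * k) ^ 1 * Real.exp (-(ε ^ 2 / 4 * k)))
      Filter.atTop (nhds 0) :=
    (Real.tendsto_pow_mul_exp_neg_atTop_nhds_zero 1).comp
      (tendsto_natCast_atTop_atTop.const_mul_atTop hc)
  obtain ⟨M, hM⟩ := Filter.eventually_atTop.1
    (h1.eventually (gt_mem_nhds (show (0 : ℝ) < ε ^ 2 / 4 * (1 / 4) by positivity)))
  obtain ⟨N, hN⟩ := exists_nat_ge (48 / ε ^ 2)
  refine ⟨max 1 (max M N), by simp, fun k hk => ?_⟩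
  have hk1 : (1 : ℝ) ≤ k := by exact_mod_cast (le_max_left _ _).trans hk
  have hkM : M ≤ k := ((le_max_left _ _).trans (le_max_right _ _)).trans hk
  have hkN : (N : ℝ) ≤ k := by
    exact_mod_cast ((le_max_right _ _).trans (le_max_right _ _)).trans hk
  have h2 := hM k hkM
  rw [pow_one, mul_assoc] at h2
  have h3 := lt_of_mul_lt_mul_left h2 hc.le
  have h4 : (2 : ℝ) ≤ Real.exp 1 := by linarith [Real.add_one_le_exp (1 : ℝ)]
  have h5 : (2 : ℝ) ^ k ≤ Real.exp k := by
    calc (2 : ℝ) ^ k ≤ Real.exp 1 ^ k := by gcongr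
      _ = Real.exp k := by rw [← Real.exp_nat_mul, mul_one]
  have h6 : (2 ^ k * 2 ^ k) * Real.exp (-(ε ^ 2 / 16 * k ^ 2)) ≤ Real.exp (-1) := by
    calc _ ≤ Real.exp k * Real.exp k * Real.exp (-(ε ^ 2 / 16 * k ^ 2)) := by gcongr
      _ = Real.exp (k + k + -(ε ^ 2 / 16 * k ^ 2)) := by rw [Real.exp_add, Real.exp_add]
      _ ≤ _ := by
        refine Real.exp_le_exp.2 ?_
        have h7 : 48 / ε ^ 2 ≤ k := hN.trans hkN
        rw [div_le_iff₀ (by positivity)] at h7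
        nlinarith
  have h7 : Real.exp (-1) ≤ 1 / 2 := by
    rw [Real.exp_neg, one_div]
    exact inv_anti₀ two_pos h4
  linarith

theorem le_eCnt_of_outDeg [Fintype V] {H : V → V → Prop} {c : ℝ} (h : ∀ x, c ≤ outDeg H x)
    (A B : Set V) : A.ncard * (c - Bᶜ.ncard) ≤ (eCnt H A B : ℝ) := by
  classical
  have h1 := eCnt_univ_le H A B
  have h2 : A.ncard * c ≤ (eCnt H A univ : ℝ) := by
    rw [eCnt_univ_right, ncard_eq_sum, Finset.sum_mul]
    refine Finset.sum_le_sum fun x _ => ?_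
    by_cases hx : x ∈ A <;> simp [hx, h x]
  linarith

theorem minOutDeg_le (G : V → V → Prop) (x : V) : minOutDeg G ≤ outDeg G x :=
  Nat.sInf_le ⟨x, rfl⟩

theorem exists_outDeg_eq_minOutDeg [Nonempty V] (G : V → V → Prop) :
    ∃ x, outDeg G x = minOutDeg G :=
  Nat.sInf_mem (range_nonempty (outDeg G))

theorem compl_iUnion_cluster {k : ℕ} (P : V → Option (Fin k)) :
    (⋃ i ∈ (Finset.univ : Finset (Fin k)), cluster P i)ᶜ = cluster0 P := by
  ext x
  simp only [Finset.mem_univ, iUnion_true, mem_compl_iff, mem_iUnion, cluster, cluster0,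
    mem_ofPred_eq]
  generalize P x = o
  cases o <;> simp

theorem card_eq_cluster0_add [Fintype V] {k m : ℕ} (P : V → Option (Fin k))
    (hm : ∀ i, (cluster P i).ncard = m) :
    Fintype.card V = (cluster0 P).ncard + k * m := by
  classical
  have h0 : (cluster0 P).ncard = (Finset.univ.filter fun x => P x = none).card := by
    simp [cluster0, Set.ncard_eq_toFinset_card']
  have h1 : ∀ i, (cluster P i).ncard = (Finset.univ.filter fun x => P x = some i).card := by
    simp [cluster, Set.ncard_eq_toFinset_card']
  rw [h0, ← Finset.card_univ,
    Finset.card_eq_sum_card_fiberwise (f := P) (t := Finset.univ) (by simp),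
    Fintype.sum_option]
  simp [← h1, hm]

theorem dens_mul [Fintype V] (G : V → V → Prop) (A B : Set V) :
    dens G A B * (A.ncard * B.ncard) = eCnt G A B := by
  rw [dens]
  by_cases h : (A.ncard * B.ncard : ℝ) = 0
  · have h1 := eCnt_le_mul G A B
    rw [h] at h1 ⊢
    simpa using (le_antisymm h1 (Nat.cast_nonneg _)).symm
  · exact div_mul_cancel₀ _ h

theorem dens_nonneg (G : V → V → Prop) (A B : Set V) : 0 ≤ dens G A B := by
  unfold dens
  positivity

theorem dens_flip [Fintype V] (G : V → V → Prop) (A B : Set V) :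
    dens (flip G) B A = dens G A B := by
  rw [dens, dens, eCnt_flip, mul_comm]

theorem dens_add_dens_le_one [Fintype V] {G : V → V → Prop} (hG : IsOriented G) (A B : Set V) :
    dens G A B + dens G B A ≤ 1 := by
  rw [dens, dens, mul_comm (B.ncard : ℝ), ← add_div]
  exact div_le_one_of_le₀ (eCnt_add_eCnt_le_mul hG A B) (by positivity)

theorem eCnt_biUnion_eq_dens [Fintype V] {k m : ℕ} (G : V → V → Prop) (P : V → Option (Fin k))
    (hm : ∀ i, (cluster P i).ncard = m) (S T : Finset (Fin k)) :
    (eCnt G (⋃ i ∈ S, cluster P i) (⋃ i ∈ T, cluster P i) : ℝ) =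
      m * (m * ∑ i ∈ S, ∑ j ∈ T, dens G (cluster P i) (cluster P j)) := by
  rw [eCnt_biUnion_cluster]
  simp only [← dens_mul, hm, Finset.mul_sum]
  refine Finset.sum_congr rfl fun i _ => Finset.sum_congr rfl fun j _ => ?_
  ring

theorem le_sum_dens_of_outDeg [Fintype V] {k m : ℕ} {H : V → V → Prop} {P : V → Option (Fin k)}
    (hm : ∀ i, (cluster P i).ncard = m) (hm0 : 0 < m) {c : ℝ} (h : ∀ x, c ≤ outDeg H x)
    (i : Fin k) :
    c - (cluster0 P).ncard ≤ m * ∑ j, dens H (cluster P i) (cluster P j) := by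
  have h1 := le_eCnt_of_outDeg h (cluster P i) (⋃ j ∈ Finset.univ, cluster P j)
  have h2 := eCnt_biUnion_eq_dens H P hm {i} Finset.univ
  simp only [Finset.mem_singleton, iUnion_iUnion_eq_left, Finset.sum_singleton] at h2
  rw [h2, compl_iUnion_cluster, hm] at h1
  exact le_of_mul_le_mul_left h1 (by exact_mod_cast hm0)

theorem outDeg_eq_eCnt [Fintype V] (G : V → V → Prop) (x : V) :
    (outDeg G x : ℝ) = eCnt G {x} univ := by
  classical
  simp [eCnt_univ_right]

theorem div_sub_mul_le {δ n m k a X : ℝ} (hn : 0 < n) (hm : 0 < m) (hk : 0 ≤ k)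
    (hmk : k * m ≤ n) (hX : 0 ≤ X) (h : δ - a * n ≤ m * X) : (δ / n - a) * k ≤ X := by
  rcases le_total (δ / n - a) 0 with hq | hq
  · exact (mul_nonpos_of_nonpos_of_nonneg hq hk).trans hX
  · refine le_of_mul_le_mul_left ?_ hm
    calc m * ((δ / n - a) * k) = (δ / n - a) * (k * m) := by ring
      _ ≤ (δ / n - a) * n := mul_le_mul_of_nonneg_left hmk hq
      _ = δ - a * n := by field_simp
      _ ≤ m * X := h

/-- A weighted digraph on `Fin k` whose edges have total weight at most one in each pair contains
an oriented subgraph in which all outdegrees, all indegrees and all edge counts are almost as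
large as the corresponding sums of weights. -/
theorem exists_oriented_subgraph_degrees {ε : ℝ} (hε0 : 0 < ε) (hε1 : ε < 1) {k : ℕ}
    (hk : (2 ^ k * 2 ^ k) * Real.exp (-(ε ^ 2 / 16 * k ^ 2)) +
      (k * Real.exp (-(ε ^ 2 / 4 * k)) + k * Real.exp (-(ε ^ 2 / 4 * k))) ≤ (1 : ℝ))
    (D : Fin k → Fin k → ℝ) (hD0 : ∀ i j, 0 ≤ D i j) (hD1 : ∀ i j, D i j + D j i ≤ 1)
    (hDdiag : ∀ i, D i i = 0) (Q : Fin k → Fin k → Prop) (hQ : ∀ i j, ¬ Q i j → D i j = 0) :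
    ∃ R : Fin k → Fin k → Prop, (∀ i j, R i j → Q i j) ∧ IsOriented R ∧
      (∀ i, ∑ j, D i j - ε * k ≤ outDeg R i) ∧
      (∀ j, ∑ i, D i j - ε * k ≤ outDeg (flip R) j) ∧
      ∀ S T : Finset (Fin k), ∑ i ∈ S, ∑ j ∈ T, D i j - ε / 2 * k ^ 2 ≤
        eCnt R (S : Set (Fin k)) (T : Set (Fin k)) := by
  obtain ⟨R, hRQ, hR, h⟩ := exists_oriented_subgraph
    (τ := (Finset (Fin k) × Finset (Fin k)) ⊕ (Fin k ⊕ Fin k)) D hD0 hD1 hDdiag Q hQ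
    (Sum.elim Prod.fst (Sum.elim (fun i => {i}) fun _ => Finset.univ))
    (Sum.elim Prod.snd (Sum.elim (fun _ => Finset.univ) fun i => {i}))
    (Sum.elim (fun _ => ε / 4) fun _ => ε / 2)
    (Sum.elim (fun _ => ε / 2 * k ^ 2) fun _ => ε * k)
    (by rintro (_ | _) <;> simp [hε0]) (by rintro (_ | _) <;> simp <;> linarith) (by
      refine le_trans ?_ hk
      simp only [Fintype.sum_sum_type, Sum.elim_inl, Sum.elim_inr]
      refine add_le_add ?_ (add_le_add ?_ ?_)
      · refine (Finset.sum_le_card_nsmul _ _ (Real.exp (-(ε ^ 2 / 16 * k ^ 2))) ?_).trans_eq ?_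
        · rintro ⟨A, B⟩ -
          have hA : (A.card : ℝ) ≤ k := by exact_mod_cast card_finset_fin_le A
          have hB : (B.card : ℝ) ≤ k := by exact_mod_cast card_finset_fin_le B
          have hAB : (A.card : ℝ) * B.card ≤ k * k := by gcongr
          refine Real.exp_le_exp.2 ?_
          have := mul_le_mul_of_nonneg_left hAB (sq_nonneg (ε / 4))
          dsimp only
          linarith
        · simp
      · refine (Finset.sum_le_card_nsmul _ _ (Real.exp (-(ε ^ 2 / 4 * k))) ?_).trans_eq ?_
        · intro i _
          refine Real.exp_le_exp.2 (le_of_eq ?_)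
          simp
          ring
        · simp
      · refine (Finset.sum_le_card_nsmul _ _ (Real.exp (-(ε ^ 2 / 4 * k))) ?_).trans_eq ?_
        · intro i _
          refine Real.exp_le_exp.2 (le_of_eq ?_)
          simp
          ring
        · simp)
  refine ⟨R, hRQ, hR, fun i => ?_, fun j => ?_, fun S T => h (.inl (S, T))⟩
  · rw [outDeg_eq_eCnt]
    simpa using h (.inr (.inl i))
  · rw [outDeg_eq_eCnt, eCnt_flip]
    simpa using h (.inr (.inr j))

/-- **Lemma 3 (reduced oriented graph).**
For every `ε ∈ (0,1)` there are `M'` and `n₀` such that: given `d ∈ [0,1]` with `ε ≤ d/2`,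
an oriented graph `G` on `n ≥ n₀` vertices, a regularity partition `V₀, V₁, …, V_k`
(`k ≥ M'`) with pure digraph `G'`, and the reduced digraph `R'` on `[k]` (where `ij ∈ E(R')`
iff the density of the `V_i`–`V_j` pair in `G'` is at least `d`), the digraph `R'` has a
spanning oriented subgraph `R` satisfying (a)–(d). -/
theorem reduced_oriented_graph :
    ∀ ε : ℝ, 0 < ε → ε < 1 →
    ∃ M' n₀ : ℕ, 0 < M' ∧ 0 < n₀ ∧
    ∀ d : ℝ, 0 ≤ d → d ≤ 1 → ε ≤ d / 2 →
    ∀ n : ℕ, n₀ ≤ n →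
    ∀ G : Fin n → Fin n → Prop, IsOriented G →
    ∀ k : ℕ, M' ≤ k →
    ∀ m : ℕ,
    ∀ P : Fin n → Option (Fin k),
    ∀ U : Fin k → Set (Fin n), (∀ i, U i = cluster P i) →
    ((cluster0 P).ncard : ℝ) ≤ ε * n →
    (∀ i, (U i).ncard = m) →
    ∀ G' : Fin n → Fin n → Prop,
    (∀ x y, G' x y → G x y) →
    (∀ x, (outDeg G x : ℝ) - (d + ε) * n < (outDeg G' x : ℝ)) →
    (∀ x, (inDeg G x : ℝ) - (d + ε) * n < (inDeg G' x : ℝ)) →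
    (∀ i : Fin k, ∀ x ∈ U i, ∀ y ∈ U i, ¬ G' x y) →
    (∀ i j : Fin k, i ≠ j → EpsRegular ε G' (U i) (U j) ∧
      (dens G' (U i) (U j) = 0 ∨ d ≤ dens G' (U i) (U j))) →
    ∀ R' : Fin k → Fin k → Prop,
    (∀ i j : Fin k, R' i j ↔ d ≤ dens G' (U i) (U j)) →
    ∃ R : Fin k → Fin k → Prop,
      (∀ i j, R i j → R' i j) ∧ IsOriented R ∧
      -- (a)
      ((minOutDeg G : ℝ) / n - (3 * ε + d)) * k ≤ (minOutDeg R : ℝ) ∧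
      -- (b)
      ((minInDeg G : ℝ) / n - (3 * ε + d)) * k ≤ (minInDeg R : ℝ) ∧
      -- (c)
      (∀ S T : Set (Fin k), Disjoint S T →
        3 * d * (n : ℝ) ^ 2 ≤ (eCnt G (⋃ i ∈ S, U i) (⋃ i ∈ T, U i) : ℝ) →
        d * (k : ℝ) ^ 2 < (eCnt R S T : ℝ)) ∧
      -- (d)
      (∀ S : Set (Fin k),
        3 * d * (n : ℝ) ^ 2 ≤ (eCnt G (⋃ i ∈ S, U i) (⋃ i ∈ S, U i) : ℝ) →
        d * (k : ℝ) ^ 2 < (eCnt R S S : ℝ)) := by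
  intro ε hε0 hε1
  obtain ⟨M, hM0, hM⟩ := exists_forall_exp_sum_le_one hε0
  refine ⟨M, 1, hM0, one_pos, ?_⟩
  intro d hd0 hd1 hεd n hn G hG k hk m P U hU hV0 hm G' hG'G hout hin hempty hreg R' hR'
  obtain rfl : U = cluster P := funext hU
  have hn0 : (0 : ℝ) < n := by exact_mod_cast hn
  have hk0 : (0 : ℝ) < k := by exact_mod_cast hM0.trans_le hk
  have hcard := card_eq_cluster0_add P hm
  rw [Fintype.card_fin] at hcard
  have hcard' : (n : ℝ) = (cluster0 P).ncard + k * m := by exact_mod_cast hcard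
  have hkm : (k : ℝ) * m ≤ n := by linarith [Nat.cast_nonneg (α := ℝ) (cluster0 P).ncard]
  have hm0 : 0 < m := by
    rcases Nat.eq_zero_or_pos m with rfl | h
    · simp only [Nat.cast_zero, mul_zero, add_zero] at hcard'
      nlinarith
    · exact h
  have hm0' : (0 : ℝ) < m := by exact_mod_cast hm0
  have hG' : IsOriented G' := fun x y h h' => hG x y (hG'G x y h) (hG'G y x h')
  have hdiag : ∀ i, dens G' (cluster P i) (cluster P i) = 0 := by
    intro i
    have h : {p : Fin n × Fin n | p.1 ∈ cluster P i ∧ p.2 ∈ cluster P i ∧ G' p.1 p.2} = ∅ :=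
      eq_empty_of_forall_notMem fun p hp => hempty i p.1 hp.1 p.2 hp.2.1 hp.2.2
    simp [dens, eCnt, h]
  obtain ⟨R, hRR', hR, hRout, hRin, hRcut⟩ := exists_oriented_subgraph_degrees hε0 hε1 (hM k hk)
    (fun i j => dens G' (cluster P i) (cluster P j)) (fun i j => dens_nonneg _ _ _)
    (fun i j => dens_add_dens_le_one hG' _ _) hdiag R' (by
      intro i j hij
      by_cases h : i = j
      · rw [h, hdiag]
      · exact (hreg i j h).2.resolve_right fun h' => hij ((hR' i j).2 h'))
  have : Nonempty (Fin k) := ⟨⟨0, hM0.trans_le hk⟩⟩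
  have hcut : ∀ S T : Set (Fin k),
      3 * d * (n : ℝ) ^ 2 ≤ (eCnt G (⋃ i ∈ S, cluster P i) (⋃ i ∈ T, cluster P i) : ℝ) →
      d * (k : ℝ) ^ 2 < (eCnt R S T : ℝ) := by
    intro S T h
    lift S to Finset (Fin k) using S.toFinite
    lift T to Finset (Fin k) using T.toFinite
    simp only [Finset.mem_coe] at h
    have h1 := h.trans (eCnt_le_of_outDeg hG'G (fun x => (hout x).le) _ _)
    rw [eCnt_biUnion_eq_dens G' P hm, Fintype.card_fin] at h1
    have h2 := hRcut S T
    set X := ∑ i ∈ S, ∑ j ∈ T, dens G' (cluster P i) (cluster P j)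
    have h3 : (3 / 2 * d) * (k * m) ^ 2 ≤ m * (m * X) := by
      calc (3 / 2 * d) * (k * m : ℝ) ^ 2 ≤ (3 / 2 * d) * n ^ 2 := by gcongr
        _ ≤ m * (m * X) := by nlinarith [mul_le_mul_of_nonneg_right hεd (sq_nonneg (n : ℝ))]
    have h4 : 3 / 2 * d * k ^ 2 ≤ X := by
      refine le_of_mul_le_mul_left ?_ (mul_pos hm0' hm0')
      linarith
    have h5 : 0 < ε * (k : ℝ) ^ 2 := by positivity
    have h6 := mul_le_mul_of_nonneg_right hεd (sq_nonneg (k : ℝ))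
    linarith
  refine ⟨R, hRR', hR, ?_, ?_, fun S T _ => hcut S T, fun S => hcut S S⟩
  · obtain ⟨i, hi⟩ := exists_outDeg_eq_minOutDeg R
    rw [← hi]
    have h1 := le_sum_dens_of_outDeg (H := G') (c := minOutDeg G - (d + ε) * n) hm hm0
      (fun x => by
        have := hout x
        have : (minOutDeg G : ℝ) ≤ outDeg G x := by exact_mod_cast minOutDeg_le G x
        linarith) i
    have h2 := div_sub_mul_le (a := 2 * ε + d) (δ := minOutDeg G) hn0 hm0' hk0.le hkm
      (Finset.sum_nonneg fun j _ => dens_nonneg G' (cluster P i) (cluster P j)) (by linarith)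
    linarith [hRout i]
  · change ((minOutDeg (flip G) : ℝ) / n - (3 * ε + d)) * k ≤ (minOutDeg (flip R) : ℝ)
    obtain ⟨i, hi⟩ := exists_outDeg_eq_minOutDeg (flip R)
    rw [← hi]
    have h1 := le_sum_dens_of_outDeg (H := flip G') (c := minOutDeg (flip G) - (d + ε) * n) hm hm0
      (fun x => by
        have : (outDeg (flip G) x : ℝ) - (d + ε) * n < outDeg (flip G') x := hin x
        have : (minOutDeg (flip G) : ℝ) ≤ outDeg (flip G) x := by
          exact_mod_cast minOutDeg_le (flip G) x
        linarith) i
    simp only [dens_flip] at h1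
    have h2 := div_sub_mul_le (a := 2 * ε + d) (δ := minOutDeg (flip G)) hn0 hm0' hk0.le hkm
      (Finset.sum_nonneg fun j _ => dens_nonneg G' (cluster P j) (cluster P i)) (by linarith)
    linarith [hRin i]

end ArxivOG
end
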